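/- arXiv:2001.03660 — 2 statements merged into one kernel-verified Lean document; each statement's English description precedes it below -/
import Mathlib

section
/- Let d ≥ 1, let θ be 0 or 1, and let f : ℝ^d → [0,∞) be Borel measurable with ∫_{B_4} f(x)^d dx < ∞. Then there exists a convex function z : B_4 → ℝ that is nonpositive on B_4 and such that: (i) for every Borel set Γ ⊆ B_4 the normal image φ(z,Γ) is Lebesgue measurable and ∫_{φ(z,Γ)} (1+θ|p|)^{−d} dp = ∫_Γ f(x)^d dx; (ii) sup_{B_4} |z| ≤ 8 Φ_θ(∫_{B_4} f^d dx). -/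
open MeasureTheory Metric
open scoped RealInnerProductSpace

/-- The normal image (union of subdifferentials relative to `B₄`) of a set `Γ`
under a convex function `z` on the ball `B₄`. -/
def normalImage {d : ℕ} (z : EuclideanSpace ℝ (Fin d) → ℝ)
    (Γ : Set (EuclideanSpace ℝ (Fin d))) : Set (EuclideanSpace ℝ (Fin d)) :=
  {p | ∃ x ∈ Γ, ∀ y ∈ ball (0 : EuclideanSpace ℝ (Fin d)) 4, z x + ⟪p, y - x⟫ ≤ z y}

namespace AlekAux

open Filter Topology BoundedContinuousFunction

variable {E : Type*} [NormedAddCommGroup E] [InnerProductSpace ℝ E]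

/-- Legendre transform of a function on the closed ball of radius 4. -/
noncomputable def star (u : closedBall (0 : E) 4 →ᵇ ℝ) (p : E) : ℝ :=
  ⨆ x : closedBall (0 : E) 4, (⟪p, (x : E)⟫ - u x)

/-- Convex envelope built from slopes in the closed ball of radius `ρ`. -/
noncomputable def env (ρ : ℝ) (u : closedBall (0 : E) 4 →ᵇ ℝ) (x : E) : ℝ :=
  ⨆ p : closedBall (0 : E) ρ, (⟪(p : E), x⟫ - star u p)

instance : Nonempty (closedBall (0 : E) 4) := ⟨⟨0, by simp⟩⟩

lemma star_bdd (u : closedBall (0 : E) 4 →ᵇ ℝ) (p : E) :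
    BddAbove (Set.range fun x : closedBall (0 : E) 4 => (⟪p, (x : E)⟫ - u x)) := by
  refine ⟨‖p‖ * 4 + ‖u‖, ?_⟩
  rintro _ ⟨x, rfl⟩
  have h1 := real_inner_le_norm p (x : E)
  have h2 : ‖(x : E)‖ ≤ 4 := mem_closedBall_zero_iff.1 x.2
  have h3 := u.norm_coe_le_norm x
  rw [Real.norm_eq_abs] at h3
  have h4 := mul_le_mul_of_nonneg_left h2 (norm_nonneg p)
  have h5 := neg_abs_le (u x)
  dsimp only
  linarith

lemma le_star (u : closedBall (0 : E) 4 →ᵇ ℝ) (p : E) (x : closedBall (0 : E) 4) :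
    ⟪p, (x : E)⟫ - u x ≤ star u p := le_ciSup (star_bdd u p) x

lemma star_le {u : closedBall (0 : E) 4 →ᵇ ℝ} {p : E} {a : ℝ}
    (h : ∀ x : closedBall (0 : E) 4, ⟪p, (x : E)⟫ - u x ≤ a) : star u p ≤ a := ciSup_le h

lemma exists_star [FiniteDimensional ℝ E] (u : closedBall (0 : E) 4 →ᵇ ℝ) (p : E) :
    ∃ x : closedBall (0 : E) 4, ⟪p, (x : E)⟫ - u x = star u p := by
  have hc : Continuous fun x : closedBall (0 : E) 4 => (⟪p, (x : E)⟫ - u x) := by fun_prop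
  obtain ⟨x, -, hx⟩ := isCompact_univ.exists_isMaxOn (Set.univ_nonempty) hc.continuousOn
  exact ⟨x, le_antisymm (le_star u p x) (star_le fun y => hx (Set.mem_univ y))⟩

lemma star_lip (u : closedBall (0 : E) 4 →ᵇ ℝ) : LipschitzWith 4 (star u) := by
  refine LipschitzWith.of_le_add_mul 4 fun p q => star_le fun x => ?_
  have h0 := le_star u q x
  have h1 := real_inner_le_norm (p - q) (x : E)
  have h2 : ‖(x : E)‖ ≤ 4 := mem_closedBall_zero_iff.1 x.2
  have h4 := mul_le_mul_of_nonneg_left h2 (norm_nonneg (p - q))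
  rw [inner_sub_left] at h1
  rw [dist_eq_norm]
  norm_num
  linarith

lemma star_le_add (u v : closedBall (0 : E) 4 →ᵇ ℝ) (p : E) :
    star u p ≤ star v p + ‖u - v‖ := by
  refine star_le fun x => ?_
  have h0 := le_star v p x
  have h3 := (u - v).norm_coe_le_norm x
  rw [Real.norm_eq_abs, BoundedContinuousFunction.sub_apply] at h3
  have h5 := neg_abs_le (u x - v x)
  linarith

lemma abs_star_sub (u v : closedBall (0 : E) 4 →ᵇ ℝ) (p : E) :
    |star u p - star v p| ≤ ‖u - v‖ := by
  have h1 := star_le_add u v p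
  have h2 := star_le_add v u p
  rw [norm_sub_rev] at h2
  rw [abs_le]; constructor <;> linarith

lemma star_zero (p : E) : |star (0 : closedBall (0 : E) 4 →ᵇ ℝ) p| ≤ 4 * ‖p‖ := by
  have h := (star_lip (0 : closedBall (0 : E) 4 →ᵇ ℝ)).dist_le_mul p 0
  have h0 : star (0 : closedBall (0 : E) 4 →ᵇ ℝ) 0 = 0 := by simp [star]
  rw [h0, Real.dist_eq, dist_zero_right, sub_zero] at h
  simpa using h

lemma abs_star_le (u : closedBall (0 : E) 4 →ᵇ ℝ) (p : E) : |star u p| ≤ 4 * ‖p‖ + ‖u‖ := by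
  have h1 := abs_star_sub u 0 p
  have h2 := star_zero (E := E) p
  rw [sub_zero] at h1
  have h3 := abs_add_le (star u p - star 0 p) (star 0 p)
  rw [sub_add_cancel] at h3
  linarith

lemma star_sub_const (u : closedBall (0 : E) 4 →ᵇ ℝ) (c : ℝ) (p : E) :
    star (u - const _ c) p = star u p + c := by
  apply le_antisymm
  · refine star_le fun x => ?_
    have := le_star u p x
    simp only [BoundedContinuousFunction.sub_apply, const_apply]
    linarith
  · rw [← le_sub_iff_add_le]
    refine star_le fun x => ?_
    have := le_star (u - const _ c) p x
    simp only [BoundedContinuousFunction.sub_apply, const_apply] at this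
    linarith

lemma env_bdd (ρ : ℝ) (u : closedBall (0 : E) 4 →ᵇ ℝ) (x : E) :
    BddAbove (Set.range fun p : closedBall (0 : E) ρ => (⟪(p : E), x⟫ - star u p)) := by
  refine ⟨ρ * ‖x‖ + (4 * ρ + ‖u‖), ?_⟩
  rintro _ ⟨p, rfl⟩
  have h1 := real_inner_le_norm (p : E) x
  have h2 : ‖(p : E)‖ ≤ ρ := mem_closedBall_zero_iff.1 p.2
  have h3 := abs_star_le u p
  have h4 := mul_le_mul_of_nonneg_right h2 (norm_nonneg x)
  have h5 := neg_abs_le (star u p)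
  dsimp only
  linarith

lemma le_env (ρ : ℝ) (u : closedBall (0 : E) 4 →ᵇ ℝ) (x : E) {p : E}
    (hp : p ∈ closedBall (0 : E) ρ) : ⟪p, x⟫ - star u p ≤ env ρ u x :=
  le_ciSup (env_bdd ρ u x) ⟨p, hp⟩

lemma env_le {ρ : ℝ} (hρ : 0 ≤ ρ) {u : closedBall (0 : E) 4 →ᵇ ℝ} {x : E} {a : ℝ}
    (h : ∀ p ∈ closedBall (0 : E) ρ, ⟪p, x⟫ - star u p ≤ a) : env ρ u x ≤ a := by
  have : Nonempty (closedBall (0 : E) ρ) := ⟨⟨0, by simpa using hρ⟩⟩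
  exact ciSup_le fun p => h p p.2

lemma env_lip (ρ : NNReal) (u : closedBall (0 : E) 4 →ᵇ ℝ) : LipschitzWith ρ (env ρ u) := by
  refine LipschitzWith.of_le_add_mul ρ fun x y => env_le ρ.2 fun p hp => ?_
  have h0 := le_env ρ u y hp
  have h1 := real_inner_le_norm p (x - y)
  have h2 : ‖p‖ ≤ ρ := by simpa using hp
  have h4 := mul_le_mul_of_nonneg_right h2 (norm_nonneg (x - y))
  rw [inner_sub_right] at h1
  rw [dist_eq_norm]
  linarith

lemma env_convex (ρ : NNReal) (u : closedBall (0 : E) 4 →ᵇ ℝ) :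
    ConvexOn ℝ Set.univ (env ρ u) := by
  refine ⟨convex_univ, fun x _ y _ a b ha hb hab => env_le ρ.2 fun p hp => ?_⟩
  have hx := mul_le_mul_of_nonneg_left (le_env ρ u x hp) ha
  have hy := mul_le_mul_of_nonneg_left (le_env ρ u y hp) hb
  rw [inner_add_right, inner_smul_right, inner_smul_right, smul_eq_mul, smul_eq_mul]
  have : star u p = a * star u p + b * star u p := by rw [← add_mul, hab, one_mul]
  linarith

lemma env_le_self (ρ : NNReal) (u : closedBall (0 : E) 4 →ᵇ ℝ) (x : closedBall (0 : E) 4) :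
    env ρ u x ≤ u x := by
  refine env_le ρ.2 fun p _ => ?_
  have := le_star u p x
  linarith

/-- The envelope as a bounded continuous function on the closed ball. -/
noncomputable def envK [FiniteDimensional ℝ E] (ρ : NNReal) (u : closedBall (0 : E) 4 →ᵇ ℝ) :
    closedBall (0 : E) 4 →ᵇ ℝ :=
  mkOfCompact ⟨fun x => env ρ u x, (env_lip ρ u).continuous.comp continuous_subtype_val⟩

@[simp] lemma envK_apply [FiniteDimensional ℝ E] (ρ : NNReal) (u : closedBall (0 : E) 4 →ᵇ ℝ)
    (x : closedBall (0 : E) 4) : envK ρ u x = env ρ u x := rfl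

lemma star_envK_le [FiniteDimensional ℝ E] (ρ : NNReal) (u : closedBall (0 : E) 4 →ᵇ ℝ) {p : E}
    (hp : p ∈ closedBall (0 : E) ρ) : star (envK ρ u) p ≤ star u p := by
  refine star_le fun x => ?_
  have := le_env ρ u x hp
  rw [envK_apply]
  linarith

set_option linter.unusedSectionVars false

section meas

variable [FiniteDimensional ℝ E] [MeasurableSpace E] [BorelSpace E]

lemma star_integrable (ν : Measure E) [IsFiniteMeasure ν] {ρ : ℝ}
    (hν : ∀ᵐ p ∂ν, p ∈ closedBall (0 : E) ρ) (u : closedBall (0 : E) 4 →ᵇ ℝ) :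
    Integrable (star u) ν := by
  refine Integrable.of_bound (star_lip u).continuous.aestronglyMeasurable (4 * ρ + ‖u‖) ?_
  filter_upwards [hν] with p hp
  have := abs_star_le u p
  have h2 : ‖p‖ ≤ ρ := by simpa using hp
  rw [Real.norm_eq_abs]
  linarith

/-- The Kantorovich dual functional. -/
noncomputable def J (μ : Measure (closedBall (0 : E) 4)) (ν : Measure E)
    (u : closedBall (0 : E) 4 →ᵇ ℝ) : ℝ := ∫ x, u x ∂μ + ∫ p, star u p ∂ν

lemma J_continuous (μ : Measure (closedBall (0 : E) 4)) [IsFiniteMeasure μ]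
    (ν : Measure E) [IsFiniteMeasure ν] {ρ : ℝ}
    (hν : ∀ᵐ p ∂ν, p ∈ closedBall (0 : E) ρ) : Continuous (J μ ν) := by
  have h1 : LipschitzWith (Real.toNNReal (μ.real Set.univ))
      fun u : closedBall (0 : E) 4 →ᵇ ℝ => ∫ x, u x ∂μ := by
    refine LipschitzWith.of_dist_le_mul fun u v => ?_
    rw [dist_eq_norm, ← integral_sub (u.integrable μ) (v.integrable μ),
      Real.coe_toNNReal _ measureReal_nonneg, mul_comm, dist_eq_norm]
    exact norm_integral_le_of_norm_le_const (ae_of_all _ fun x => (u - v).norm_coe_le_norm x)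
  have h2 : LipschitzWith (Real.toNNReal (ν.real Set.univ))
      fun u : closedBall (0 : E) 4 →ᵇ ℝ => ∫ p, star u p ∂ν := by
    refine LipschitzWith.of_dist_le_mul fun u v => ?_
    rw [dist_eq_norm, ← integral_sub (star_integrable ν hν u) (star_integrable ν hν v),
      Real.coe_toNNReal _ measureReal_nonneg, mul_comm, dist_eq_norm]
    exact norm_integral_le_of_norm_le_const (ae_of_all _ fun p => abs_star_sub u v p)
  exact h1.continuous.add h2.continuous

lemma J_sub_const (μ : Measure (closedBall (0 : E) 4)) [IsFiniteMeasure μ]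
    (ν : Measure E) [IsFiniteMeasure ν] {ρ : ℝ}
    (hν : ∀ᵐ p ∂ν, p ∈ closedBall (0 : E) ρ) (hm : μ Set.univ = ν Set.univ)
    (u : closedBall (0 : E) 4 →ᵇ ℝ) (c : ℝ) : J μ ν (u - const _ c) = J μ ν u := by
  have hm' : μ.real Set.univ = ν.real Set.univ := by simp [Measure.real, hm]
  unfold J
  simp_rw [star_sub_const, BoundedContinuousFunction.sub_apply, const_apply]
  rw [integral_sub (u.integrable μ) (integrable_const _),
    integral_add (star_integrable ν hν u) (integrable_const _)]
  simp [hm']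

lemma J_envK_le (μ : Measure (closedBall (0 : E) 4)) [IsFiniteMeasure μ]
    (ν : Measure E) [IsFiniteMeasure ν] {ρ : NNReal}
    (hν : ∀ᵐ p ∂ν, p ∈ closedBall (0 : E) ρ)
    (u : closedBall (0 : E) 4 →ᵇ ℝ) : J μ ν (envK ρ u) ≤ J μ ν u := by
  unfold J
  refine add_le_add (integral_mono ((envK ρ u).integrable μ) (u.integrable μ)
    fun x => env_le_self ρ u x) (integral_mono_ae (star_integrable ν hν _)
      (star_integrable ν hν _) ?_)
  filter_upwards [hν] with p hp using star_envK_le ρ u hp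

lemma exists_min (μ : Measure (closedBall (0 : E) 4)) [IsFiniteMeasure μ]
    (ν : Measure E) [IsFiniteMeasure ν] {ρ : NNReal}
    (hν : ∀ᵐ p ∂ν, p ∈ closedBall (0 : E) ρ) (hm : μ Set.univ = ν Set.univ) :
    ∃ u : closedBall (0 : E) 4 →ᵇ ℝ, ∀ v, J μ ν (envK ρ u) ≤ J μ ν v := by
  let o : closedBall (0 : E) 4 := ⟨0, by simp⟩
  let A : Set (closedBall (0 : E) 4 →ᵇ ℝ) := {u | LipschitzWith ρ u ∧ u o = 0}
  have hcl : IsClosed A := by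
    have : A = {u | ∀ x y, dist (u x) (u y) ≤ ρ * dist x y} ∩ {u | u o = 0} := by
      ext u
      simp only [A, Set.mem_ofPred_eq, Set.mem_inter_iff, lipschitzWith_iff_dist_le_mul]
    rw [this]
    refine IsClosed.inter ?_ ?_
    · simp only [Set.ofPred_forall]
      refine isClosed_iInter fun x => isClosed_iInter fun y => isClosed_le ?_ continuous_const
      exact (continuous_eval_const (x := x)).dist (continuous_eval_const (x := y))
    · exact isClosed_eq (continuous_eval_const (x := o)) continuous_const
  have hA : IsCompact A := by
    refine arzela_ascoli₂ (closedBall (0 : ℝ) (ρ * 4)) (isCompact_closedBall _ _) A hcl ?_ ?_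
    · rintro u x ⟨hu, h0⟩
      have h := hu.dist_le_mul x o
      rw [h0] at h
      have h2 : dist x o ≤ 4 := x.2
      exact h.trans (mul_le_mul_of_nonneg_left h2 ρ.2)
    · exact (LipschitzWith.uniformEquicontinuous _ ρ fun u => u.2.1).equicontinuous
  obtain ⟨u, hu, hmin⟩ := hA.exists_isMinOn ⟨0, by
    refine ⟨?_, rfl⟩
    exact LipschitzWith.const' 0⟩ (J_continuous μ ν hν).continuousOn
  refine ⟨u, fun v => (J_envK_le μ ν hν u).trans ?_⟩
  have hv : envK ρ v - const _ (env ρ v 0) ∈ A := by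
    refine ⟨?_, by simp [o]⟩
    refine LipschitzWith.of_dist_le_mul fun x y => ?_
    have := (env_lip ρ v).dist_le_mul (x : E) y
    simpa [Subtype.dist_eq] using this
  have h1 := hmin hv
  simp only [Set.mem_ofPred_eq] at h1
  rw [J_sub_const μ ν hν hm] at h1
  exact h1.trans (J_envK_le μ ν hν v)

end meas

lemma max_eq_grad [FiniteDimensional ℝ E] (u : closedBall (0 : E) 4 →ᵇ ℝ) {p : E}
    (hd : DifferentiableAt ℝ (star u) p) {x : closedBall (0 : E) 4}
    (hx : ⟪p, (x : E)⟫ - u x = star u p) : (x : E) = gradient (star u) p := by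
  have h1 : HasFDerivAt (fun q => star u q - innerSL ℝ (x : E) q)
      (fderiv ℝ (star u) p - innerSL ℝ (x : E)) p :=
    hd.hasFDerivAt.sub (innerSL ℝ (x : E)).hasFDerivAt
  have hmin : IsLocalMin (fun q => star u q - innerSL ℝ (x : E) q) p := by
    refine Eventually.of_forall fun q => ?_
    have h := le_star u q x
    simp only [innerSL_apply_apply]
    rw [real_inner_comm] at h hx
    linarith
  have h2 := hmin.hasFDerivAt_eq_zero h1
  rw [sub_eq_zero] at h2
  unfold gradient
  rw [h2, LinearIsometryEquiv.eq_symm_apply]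
  ext y
  simp

lemma danskin [FiniteDimensional ℝ E] (u h : closedBall (0 : E) 4 →ᵇ ℝ) {p : E}
    (hd : DifferentiableAt ℝ (star u) p) {x : closedBall (0 : E) 4}
    (hx : ⟪p, (x : E)⟫ - u x = star u p) (t : ℕ → ℝ) (ht : ∀ n, 0 < t n)
    (ht0 : Tendsto t atTop (𝓝 0)) :
    Tendsto (fun n => (star (u + t n • h) p - star u p) / t n) atTop (𝓝 (- h x)) := by
  choose y hy using fun n => exists_star (u + t n • h) p
  have hlow : ∀ n, - h x ≤ (star (u + t n • h) p - star u p) / t n := fun n => by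
    rw [le_div_iff₀ (ht n)]
    have := le_star (u + t n • h) p x
    simp only [BoundedContinuousFunction.add_apply, BoundedContinuousFunction.smul_apply,
      smul_eq_mul] at this
    linarith
  have hup : ∀ n, (star (u + t n • h) p - star u p) / t n ≤ - h (y n) := fun n => by
    rw [div_le_iff₀ (ht n)]
    have h1 := le_star u p (y n)
    have := hy n
    simp only [BoundedContinuousFunction.add_apply, BoundedContinuousFunction.smul_apply,
      smul_eq_mul] at this
    linarith
  have hgap : Tendsto (fun n => star u p - (⟪p, (y n : E)⟫ - u (y n))) atTop (𝓝 0) := by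
    have hb : Tendsto (fun n => t n * (2 * ‖h‖)) atTop (𝓝 0) := by
      simpa using ht0.mul_const (2 * ‖h‖)
    refine squeeze_zero (fun n => sub_nonneg.2 (le_star u p (y n))) (fun n => ?_) hb
    have h1 := (hlow n)
    rw [le_div_iff₀ (ht n)] at h1
    have h2 := hy n
    simp only [BoundedContinuousFunction.add_apply, BoundedContinuousFunction.smul_apply,
      smul_eq_mul] at h2
    have h3 := abs_le.1 (h.norm_coe_le_norm x)
    have h4 := abs_le.1 (h.norm_coe_le_norm (y n))
    have h5 := mul_le_mul_of_nonneg_left h3.2 (ht n).le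
    have h6 := mul_le_mul_of_nonneg_left h4.1 (ht n).le
    linarith
  have hy' : Tendsto y atTop (𝓝 x) := by
    refine isCompact_univ.tendsto_nhds_of_unique_mapClusterPt (by simp) fun w _ hw => ?_
    have hc : Continuous fun w : closedBall (0 : E) 4 => star u p - (⟪p, (w : E)⟫ - u w) := by
      fun_prop
    obtain ⟨ψ, hψ, hψt⟩ := hw.tendsto_subseq
    have h2 : star u p - (⟪p, (w : E)⟫ - u w) = 0 :=
      tendsto_nhds_unique ((hc.tendsto w).comp hψt) (hgap.comp hψ.tendsto_atTop)
    have h3 : ⟪p, (w : E)⟫ - u w = star u p := by linarith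
    exact Subtype.ext ((max_eq_grad u hd h3).trans (max_eq_grad u hd hx).symm)
  refine tendsto_of_tendsto_of_tendsto_of_le_of_le tendsto_const_nhds ?_ hlow hup
  exact ((h.continuous.tendsto x).comp hy').neg

section meas2

variable [FiniteDimensional ℝ E] [MeasurableSpace E] [BorelSpace E]

lemma measurable_gradient (g : E → ℝ) : Measurable (gradient g) := by
  unfold gradient
  exact ((InnerProductSpace.toDual ℝ E).symm.continuous.measurable).comp (measurable_fderiv ℝ g)

lemma ineq_of_min (μ : Measure (closedBall (0 : E) 4)) [IsFiniteMeasure μ]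
    (ν : Measure E) [IsFiniteMeasure ν] {ρ : ℝ}
    (hν : ∀ᵐ p ∂ν, p ∈ closedBall (0 : E) ρ) (hac : ν ≪ volume)
    (u : closedBall (0 : E) 4 →ᵇ ℝ) (hu : ∀ v, J μ ν u ≤ J μ ν v) (h : E →ᵇ ℝ) :
    ∫ p, h (gradient (star u) p) ∂ν ≤ ∫ x, h x ∂μ := by
  let hK : closedBall (0 : E) 4 →ᵇ ℝ := h.compContinuous ⟨Subtype.val, continuous_subtype_val⟩
  let t : ℕ → ℝ := fun n => 1 / ((n : ℝ) + 1)
  have ht : ∀ n, 0 < t n := fun n => by positivity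
  have ht0 : Tendsto t atTop (𝓝 0) := tendsto_one_div_add_atTop_nhds_zero_nat
  have hlim : Tendsto (fun n => ∫ p, (star (u + t n • hK) p - star u p) / t n ∂ν) atTop
      (𝓝 (∫ p, - h (gradient (star u) p) ∂ν)) := by
    refine tendsto_integral_of_dominated_convergence (fun _ => ‖hK‖) (fun n => ?_)
      (integrable_const _) (fun n => ae_of_all _ fun p => ?_) ?_
    · exact (((star_lip _).continuous.sub (star_lip _).continuous).div_const
        _).aestronglyMeasurable
    · rw [norm_div, Real.norm_of_nonneg (ht n).le, div_le_iff₀ (ht n), Real.norm_eq_abs]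
      have := abs_star_sub (u + t n • hK) u p
      rwa [add_sub_cancel_left, norm_smul, Real.norm_of_nonneg (ht n).le, mul_comm] at this
    · filter_upwards [hac.ae_le ((star_lip u).ae_differentiableAt (μ := volume))] with p hp
      obtain ⟨x, hx⟩ := exists_star u p
      have := danskin u hK hp hx t ht ht0
      rw [← max_eq_grad u hp hx]
      exact this
  have hpos : ∀ n, 0 ≤ ∫ x, h x ∂μ + ∫ p, (star (u + t n • hK) p - star u p) / t n ∂ν := by
    intro n
    have h1 := hu (u + t n • hK)
    unfold J at h1
    have h2 : ∫ x, (u + t n • hK) x ∂μ = ∫ x, u x ∂μ + t n * ∫ x, h x ∂μ := by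
      rw [← integral_const_mul]
      exact integral_add (u.integrable μ) ((hK.integrable μ).const_mul (t n))
    rw [integral_div, integral_sub (star_integrable ν hν _) (star_integrable ν hν _)]
    rw [h2] at h1
    have h3 : 0 ≤ (∫ x, h x ∂μ) * t n + (∫ p, star (u + t n • hK) p ∂ν - ∫ p, star u p ∂ν) := by
      linarith
    have h4 := div_nonneg h3 (ht n).le
    rwa [add_div, mul_div_cancel_right₀ _ (ht n).ne'] at h4
  have := ge_of_tendsto' (hlim.const_add (∫ x, h x ∂μ)) hpos
  rw [integral_neg] at this
  linarith

/-- Existence of the optimal transport potential. -/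
lemma transport (μ ν : Measure E) [IsFiniteMeasure μ] [IsFiniteMeasure ν] {ρ : NNReal}
    (hμ : ∀ᵐ p ∂μ, p ∈ closedBall (0 : E) 4)
    (hν : ∀ᵐ p ∂ν, p ∈ closedBall (0 : E) ρ) (hac : ν ≪ volume)
    (hm : μ Set.univ = ν Set.univ) :
    ∃ u : closedBall (0 : E) 4 →ᵇ ℝ,
      Measure.map (gradient (star (envK ρ u))) ν = μ := by
  let μ' : Measure (closedBall (0 : E) 4) := Measure.comap Subtype.val μ
  have hmap : Measure.map Subtype.val μ' = μ := by
    rw [map_comap_subtype_coe isClosed_closedBall.measurableSet]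
    exact Measure.restrict_eq_self_of_ae_mem hμ
  have hfin : IsFiniteMeasure μ' := by
    refine ⟨?_⟩
    have : Measure.map Subtype.val μ' Set.univ < ⊤ := by rw [hmap]; exact measure_lt_top _ _
    rwa [Measure.map_apply measurable_subtype_coe MeasurableSet.univ, Set.preimage_univ] at this
  have hm' : μ' Set.univ = ν Set.univ := by
    rw [← hm, ← hmap, Measure.map_apply measurable_subtype_coe MeasurableSet.univ,
      Set.preimage_univ]
  obtain ⟨u, hu⟩ := exists_min μ' ν hν hm'
  refine ⟨u, ?_⟩
  have hT := measurable_gradient (star (envK ρ u))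
  refine ext_of_forall_integral_eq_of_IsFiniteMeasure fun h => ?_
  rw [integral_map hT.aemeasurable h.continuous.aestronglyMeasurable]
  conv_rhs => rw [← hmap]
  rw [integral_map measurable_subtype_coe.aemeasurable h.continuous.aestronglyMeasurable]
  have h1 := ineq_of_min μ' ν hν hac (envK ρ u) hu h
  have h2 := ineq_of_min μ' ν hν hac (envK ρ u) hu (-h)
  simp only [BoundedContinuousFunction.neg_apply, integral_neg] at h2
  linarith

end meas2

/-- The weight as a function of the norm. -/
noncomputable def wt (d : ℕ) (θ y : ℝ) : ℝ := (1 + θ * |y|) ^ (-(d : ℝ))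

lemma wt_cont (d : ℕ) {θ : ℝ} (h0 : 0 ≤ θ) : Continuous (wt d θ) := by
  unfold wt
  refine Continuous.rpow_const (by fun_prop) fun y => Or.inl ?_
  positivity

lemma wt_pos (d : ℕ) {θ : ℝ} (h0 : 0 ≤ θ) (y : ℝ) : 0 < wt d θ y := by
  unfold wt; positivity

lemma radial (d : ℕ) (hd : 1 ≤ d) (θ : ℝ) (ρ : ℝ) (hρ : 0 ≤ ρ) :
    ∫ p in closedBall (0 : EuclideanSpace ℝ (Fin d)) ρ, wt d θ ‖p‖ =
      d * (volume.real (ball (0 : EuclideanSpace ℝ (Fin d)) 1) *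
        ∫ y in (0:ℝ)..ρ, y ^ (d - 1) * wt d θ y) := by
  have : Nontrivial (EuclideanSpace ℝ (Fin d)) := by
    have : Nonempty (Fin d) := ⟨⟨0, hd⟩⟩
    infer_instance
  have h := integral_fun_norm_addHaar (volume : Measure (EuclideanSpace ℝ (Fin d)))
    ((Set.Iic ρ).indicator (wt d θ))
  rw [← integral_indicator isClosed_closedBall.measurableSet]
  have h1 : (closedBall (0 : EuclideanSpace ℝ (Fin d)) ρ).indicator (fun p => wt d θ ‖p‖) =
      fun p => (Set.Iic ρ).indicator (wt d θ) ‖p‖ := by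
    ext p
    simp [Set.indicator]
  rw [h1, h, finrank_euclideanSpace_fin, nsmul_eq_mul, smul_eq_mul,
    intervalIntegral.integral_of_le hρ]
  congr 2
  have h2 : (fun y : ℝ => y ^ (d - 1) • (Set.Iic ρ).indicator (wt d θ) y) =
      (Set.Iic ρ).indicator (fun y => y ^ (d - 1) * wt d θ y) := by
    ext y
    by_cases hy : y ∈ Set.Iic ρ <;> simp [Set.indicator, hy]
  rw [h2, setIntegral_indicator measurableSet_Iic, Set.Ioi_inter_Iic]

lemma exists_radius (d : ℕ) (hd : 1 ≤ d) (θ : ℝ) (h0 : 0 ≤ θ) (h1 : θ ≤ 1) (m : ℝ) (hm : 0 ≤ m) :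
    ∃ ρ : ℝ, 0 ≤ ρ ∧ ∫ p in closedBall (0 : EuclideanSpace ℝ (Fin d)) ρ, wt d θ ‖p‖ = m := by
  set c := volume.real (ball (0 : EuclideanSpace ℝ (Fin d)) 1) with hc
  have hcpos : 0 < c := by
    rw [hc, Measure.real]
    exact ENNReal.toReal_pos (measure_ball_pos _ _ one_pos).ne' measure_ball_lt_top.ne
  have hdpos : (0 : ℝ) < d := by exact_mod_cast hd
  have hk : Continuous fun y : ℝ => y ^ (d - 1) * wt d θ y :=
    (continuous_pow _).mul (wt_cont d h0)
  have hH : Continuous fun ρ : ℝ => ∫ y in (0:ℝ)..ρ, y ^ (d - 1) * wt d θ y :=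
    intervalIntegral.continuous_primitive (fun a b => hk.intervalIntegrable a b) 0
  set m' := m / (d * c) with hm'
  have hm'0 : 0 ≤ m' := by positivity
  set R := Real.exp (2 ^ d * m') with hR
  have hR1 : 1 ≤ R := Real.one_le_exp (by positivity)
  have hbig : m' ≤ ∫ y in (0:ℝ)..R, y ^ (d - 1) * wt d θ y := by
    rw [← intervalIntegral.integral_add_adjacent_intervals (hk.intervalIntegrable 0 1)
      (hk.intervalIntegrable 1 R)]
    have i1 : 0 ≤ ∫ y in (0:ℝ)..1, y ^ (d - 1) * wt d θ y := by
      refine intervalIntegral.integral_nonneg zero_le_one fun y hy => ?_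
      exact mul_nonneg (pow_nonneg hy.1 _) (wt_pos d h0 y).le
    have i2 : ∫ y in (1:ℝ)..R, (2 ^ d)⁻¹ * y⁻¹ ≤ ∫ y in (1:ℝ)..R, y ^ (d - 1) * wt d θ y := by
      refine intervalIntegral.integral_mono_on hR1 ?_ (hk.intervalIntegrable 1 R) fun y hy => ?_
      · refine (ContinuousOn.intervalIntegrable ?_)
        refine continuousOn_const.mul (continuousOn_inv₀.mono fun y hy => ?_)
        rw [Set.uIcc_of_le hR1] at hy
        have : 0 < y := lt_of_lt_of_le one_pos hy.1
        exact this.ne'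
      · have hy0 : 0 < y := lt_of_lt_of_le one_pos hy.1
        have e1 : wt d θ y = ((1 + θ * y) ^ d)⁻¹ := by
          rw [wt, abs_of_pos hy0, Real.rpow_neg (by positivity), Real.rpow_natCast]
        have e2 : (1 + θ * y) ^ d ≤ (2 * y) ^ d := by
          refine pow_le_pow_left₀ (by positivity) ?_ d
          have := mul_le_mul_of_nonneg_right h1 hy0.le
          have := hy.1
          linarith
        rw [e1]
        calc (2 ^ d)⁻¹ * y⁻¹ = y ^ (d - 1) * ((2 * y) ^ d)⁻¹ := by
              obtain ⟨k, rfl⟩ : ∃ k, d = k + 1 := ⟨d - 1, by omega⟩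
              rw [Nat.add_sub_cancel, mul_pow, pow_succ y]
              field_simp
          _ ≤ _ := by gcongr
    rw [intervalIntegral.integral_const_mul, integral_inv_of_pos one_pos (by positivity), div_one,
      hR, Real.log_exp, ← mul_assoc, inv_mul_cancel₀ (by positivity), one_mul, ← hR] at i2
    linarith
  have hivt := intermediate_value_Icc (zero_le_one.trans hR1) hH.continuousOn
  obtain ⟨ρ, hρ, hρm⟩ := hivt (show m' ∈ _ from ⟨by simpa using hm'0, hbig⟩)
  refine ⟨ρ, hρ.1, ?_⟩
  rw [radial d hd θ ρ hρ.1]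
  dsimp only at hρm
  rw [hρm, hm', ← hc]
  field_simp

/-- Characterization of the normal image at points of differentiability. -/
lemma mem_normalImage_iff {d : ℕ} (ρ : NNReal)
    (u : closedBall (0 : EuclideanSpace ℝ (Fin d)) 4 →ᵇ ℝ) (C : ℝ)
    {Γ : Set (EuclideanSpace ℝ (Fin d))} (hΓ : Γ ⊆ ball 0 4) {p : EuclideanSpace ℝ (Fin d)}
    (hp : DifferentiableAt ℝ (star (envK ρ u)) p) :
    p ∈ normalImage (fun x => env ρ u x - C) Γ ↔
      p ∈ closedBall 0 (ρ : ℝ) ∩ gradient (star (envK ρ u)) ⁻¹' Γ := by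
  constructor
  · rintro ⟨x, hxΓ, hx⟩
    have hxb := hΓ hxΓ
    have hx' : ∀ y ∈ ball (0 : EuclideanSpace ℝ (Fin d)) 4,
        env ρ u x + ⟪p, y - x⟫ ≤ env ρ u y := fun y hy => by
      have := hx y hy
      dsimp only at this
      linarith
    constructor
    · rw [mem_closedBall_zero_iff]
      obtain ⟨ε, hε, hball⟩ := Metric.isOpen_iff.1 isOpen_ball x hxb
      by_contra! hlt
      have hp0 : 0 < ‖p‖ := lt_of_le_of_lt ρ.2 hlt
      set s := ε / 2 / ‖p‖ with hs
      have hs0 : 0 < s := by positivity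
      have hmem : x + s • p ∈ ball x ε := by
        rw [mem_ball, dist_eq_norm, add_sub_cancel_left, norm_smul, Real.norm_of_nonneg hs0.le, hs,
          div_mul_cancel₀ _ hp0.ne']
        linarith
      have h1 := hx' _ (hball hmem)
      rw [add_sub_cancel_left, inner_smul_right, real_inner_self_eq_norm_sq] at h1
      have h2 := (env_lip ρ u).dist_le_mul (x + s • p) x
      rw [dist_eq_norm, dist_eq_norm, add_sub_cancel_left, norm_smul,
        Real.norm_of_nonneg hs0.le] at h2
      have h3 := (le_abs_self _).trans h2
      have h4 : 0 < s * ‖p‖ * (‖p‖ - ρ) := mul_pos (mul_pos hs0 hp0) (sub_pos.2 hlt)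
      nlinarith
    · have hcl : ∀ y ∈ closedBall (0 : EuclideanSpace ℝ (Fin d)) 4,
          env ρ u x + ⟪p, y - x⟫ ≤ env ρ u y := by
        intro y hy
        rw [← closure_ball _ (by norm_num : (4:ℝ) ≠ 0)] at hy
        have hclosed : IsClosed {y | env ρ u x + ⟪p, y - x⟫ ≤ env ρ u y} :=
          isClosed_le (by fun_prop) (env_lip ρ u).continuous
        exact closure_minimal hx' hclosed hy
      have hmax : ⟪p, x⟫ - envK ρ u ⟨x, ball_subset_closedBall hxb⟩ = star (envK ρ u) p := by
        refine le_antisymm (le_star (envK ρ u) p ⟨x, _⟩) (star_le fun y => ?_)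
        have := hcl y y.2
        rw [inner_sub_right] at this
        simp only [envK_apply]
        linarith
      have := max_eq_grad (envK ρ u) hp (x := ⟨x, ball_subset_closedBall hxb⟩) hmax
      rw [Set.mem_preimage, ← this]
      exact hxΓ
  · rintro ⟨hpρ, hpΓ⟩
    obtain ⟨x, hx⟩ := exists_star (envK ρ u) p
    rw [Set.mem_preimage, ← max_eq_grad (envK ρ u) hp hx] at hpΓ
    refine ⟨x, hpΓ, fun y hy => ?_⟩
    have h := le_star (envK ρ u) p ⟨y, ball_subset_closedBall hy⟩
    rw [← hx] at h
    simp only [envK_apply] at h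
    rw [inner_sub_right]
    dsimp only
    linarith

end AlekAux

open AlekAux in
/-- Aleksandrov's existence theorem for the Monge–Ampère type equation
`∫_{φ(z,Γ)} (1+θ|p|)^{-d} dp = ∫_Γ f^d dx` on `B₄`, together with the bound
`|z| ≤ 8 Φ_θ(∫_{B₄} f^d)`, where `Φ_θ` is the inverse of
`ρ ↦ ∫_{|p|≤ρ} (1+θ|p|)^{-d} dp`. -/
theorem aleksandrov_existence (d : ℕ) (hd : 1 ≤ d) (θ : ℝ) (hθ : θ = 0 ∨ θ = 1)
    (Φ : ℝ → ℝ)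
    (hΦ : ∀ ρ : ℝ, 0 ≤ ρ →
      Φ (∫ p in closedBall (0 : EuclideanSpace ℝ (Fin d)) ρ,
          (1 + θ * ‖p‖) ^ (-(d : ℝ))) = ρ)
    (f : EuclideanSpace ℝ (Fin d) → ℝ) (hf_meas : Measurable f) (hf0 : ∀ x, 0 ≤ f x)
    (hf_int : IntegrableOn (fun x => f x ^ d)
      (ball (0 : EuclideanSpace ℝ (Fin d)) 4)) :
    ∃ z : EuclideanSpace ℝ (Fin d) → ℝ,
      ConvexOn ℝ (ball (0 : EuclideanSpace ℝ (Fin d)) 4) z ∧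
      (∀ x ∈ ball (0 : EuclideanSpace ℝ (Fin d)) 4, z x ≤ 0) ∧
      (∀ Γ : Set (EuclideanSpace ℝ (Fin d)), MeasurableSet Γ →
        Γ ⊆ ball (0 : EuclideanSpace ℝ (Fin d)) 4 →
        NullMeasurableSet (normalImage z Γ) volume ∧
        ∫ p in normalImage z Γ, (1 + θ * ‖p‖) ^ (-(d : ℝ)) = ∫ x in Γ, f x ^ d) ∧
      (∀ x ∈ ball (0 : EuclideanSpace ℝ (Fin d)) 4,
        |z x| ≤ 8 * Φ (∫ y in ball (0 : EuclideanSpace ℝ (Fin d)) 4, f y ^ d)) := by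
  have hθ0 : 0 ≤ θ := by rcases hθ with rfl | rfl <;> norm_num
  have hθ1 : θ ≤ 1 := by rcases hθ with rfl | rfl <;> norm_num
  have hwt : ∀ p : EuclideanSpace ℝ (Fin d), (1 + θ * ‖p‖) ^ (-(d : ℝ)) = wt d θ ‖p‖ := by
    intro p; rw [wt, abs_norm]
  simp_rw [hwt] at hΦ ⊢
  have hg : Continuous fun p : EuclideanSpace ℝ (Fin d) => wt d θ ‖p‖ :=
    (wt_cont d hθ0).comp continuous_norm
  have hgpos : ∀ p : EuclideanSpace ℝ (Fin d), 0 ≤ wt d θ ‖p‖ := fun p => (wt_pos d hθ0 _).le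
  have hfd : ∀ x, 0 ≤ f x ^ d := fun x => pow_nonneg (hf0 x) d
  obtain ⟨ρ', hρ0, hρ⟩ := exists_radius d hd θ hθ0 hθ1
    (∫ y in ball (0 : EuclideanSpace ℝ (Fin d)) 4, f y ^ d) (integral_nonneg hfd)
  lift ρ' to NNReal using hρ0 with ρ
  have hg_int : IntegrableOn (fun p : EuclideanSpace ℝ (Fin d) => wt d θ ‖p‖)
      (closedBall 0 (ρ : ℝ)) :=
    hg.continuousOn.integrableOn_compact (isCompact_closedBall _ _)
  have hΦρ : Φ (∫ y in ball (0 : EuclideanSpace ℝ (Fin d)) 4, f y ^ d) = ρ := by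
    rw [← hρ]; exact hΦ ρ ρ.2
  rw [hΦρ]
  -- the two measures
  let μ : Measure (EuclideanSpace ℝ (Fin d)) :=
    (volume.restrict (ball 0 4)).withDensity fun x => ENNReal.ofReal (f x ^ d)
  let ν : Measure (EuclideanSpace ℝ (Fin d)) :=
    (volume.restrict (closedBall 0 (ρ : ℝ))).withDensity fun p => ENNReal.ofReal (wt d θ ‖p‖)
  have hμfin : IsFiniteMeasure μ := isFiniteMeasure_withDensity_ofReal hf_int.2
  have hνfin : IsFiniteMeasure ν := isFiniteMeasure_withDensity_ofReal hg_int.2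
  have hμac : μ ≪ volume.restrict (ball 0 4) := withDensity_absolutelyContinuous _ _
  have hνac : ν ≪ volume.restrict (closedBall 0 (ρ : ℝ)) := withDensity_absolutelyContinuous _ _
  have hμs : ∀ S, MeasurableSet S → μ S = ENNReal.ofReal (∫ x in S ∩ ball 0 4, f x ^ d) := by
    intro S hS
    rw [withDensity_apply _ hS, Measure.restrict_restrict hS,
      ofReal_integral_eq_lintegral_ofReal (hf_int.mono_set Set.inter_subset_right)
        (ae_of_all _ hfd)]
  have hνs : ∀ S, MeasurableSet S →
      ν S = ENNReal.ofReal (∫ p in S ∩ closedBall 0 (ρ : ℝ), wt d θ ‖p‖) := by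
    intro S hS
    rw [withDensity_apply _ hS, Measure.restrict_restrict hS,
      ofReal_integral_eq_lintegral_ofReal (hg_int.mono_set Set.inter_subset_right)
        (ae_of_all _ hgpos)]
  obtain ⟨u, hu⟩ := transport μ ν (ρ := ρ)
    (hμac.ae_le ((ae_restrict_mem isOpen_ball.measurableSet).mono
      fun x hx => ball_subset_closedBall hx))
    (hνac.ae_le (ae_restrict_mem isClosed_closedBall.measurableSet))
    (hνac.trans Measure.restrict_le_self.absolutelyContinuous)
    (by rw [hμs _ MeasurableSet.univ, hνs _ MeasurableSet.univ, Set.univ_inter, Set.univ_inter, hρ])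
  obtain ⟨x₀, hx₀, hmax⟩ := (isCompact_closedBall (0 : EuclideanSpace ℝ (Fin d)) 4).exists_isMaxOn
    ⟨0, by simp⟩ (env_lip ρ u).continuous.continuousOn
  have hle : ∀ x ∈ ball (0 : EuclideanSpace ℝ (Fin d)) 4, env ρ u x - env ρ u x₀ ≤ 0 :=
    fun x hx => sub_nonpos.2 (hmax (ball_subset_closedBall hx))
  refine ⟨fun x => env ρ u x - env ρ u x₀, ?_, hle, ?_, ?_⟩
  · have := ((env_convex ρ u).subset (Set.subset_univ _) (convex_ball 0 4)).add_const
      (-env ρ u x₀)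
    exact this
  · intro Γ hΓ hΓs
    have hT := measurable_gradient (AlekAux.star (envK ρ u))
    have hae : normalImage (fun x => env ρ u x - env ρ u x₀) Γ =ᵐ[volume]
        (closedBall 0 (ρ : ℝ) ∩ gradient (AlekAux.star (envK ρ u)) ⁻¹' Γ :
          Set (EuclideanSpace ℝ (Fin d))) := by
      filter_upwards [(star_lip (envK ρ u)).ae_differentiableAt (μ := volume)] with p hp
      exact propext (mem_normalImage_iff ρ u _ hΓs hp)
    refine ⟨((isClosed_closedBall.measurableSet.inter (hT hΓ)).nullMeasurableSet).congr hae.symm,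
      ?_⟩
    rw [setIntegral_congr_set hae, Set.inter_comm]
    have h1 := hμs Γ hΓ
    rw [← hu, Measure.map_apply hT hΓ, hνs _ (hT hΓ), Set.inter_eq_left.2 hΓs] at h1
    exact (ENNReal.ofReal_eq_ofReal_iff (integral_nonneg hgpos) (integral_nonneg hfd)).1 h1
  · intro x hx
    have h1 := (env_lip ρ u).dist_le_mul x x₀
    rw [Real.dist_eq] at h1
    have h2 : dist x x₀ ≤ 8 := by
      have h3 := dist_triangle_right x x₀ 0
      have h4 := mem_ball.1 hx
      have h5 := mem_closedBall.1 hx₀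
      linarith
    have h3 := mul_le_mul_of_nonneg_left h2 ρ.2
    dsimp only
    change (ρ : ℝ) * dist x x₀ ≤ ρ * 8 at h3
    linarith
end

section
/- Let d ≥ 1, let θ be 0 or 1, and let f : ℝ^d → [0,∞) be Borel measurable, vanishing outside B_2, with ∫_{B_2} f^d dx < ∞. Then there exists a convex function z : B_4 → ℝ, nonpositive on B_4, such that: (a) |z(x)| ≤ 8 Φ_θ(∫_{B_2} f^d dx) for all x ∈ B_4; (b) for every mollifier ζ, every ε ∈ (0,2), every symmetric positive semidefinite d×d real matrix a = (a^{ij}), and every x ∈ B_2, one has ∑_{i,j} a^{ij} D_{ij} z^{(ε)}(x) ≥ d (det a)^{1/d} · ((f · (1 + θ|∇z|))^{(ε)})(x), where ∇z denotes the gradient of z (which exists Lebesgue-almost everywhere on B_4 since z is convex), and where for ε ∈ (0,2) and x ∈ B_2 the convolutions u^{(ε)}(x) = ∫ u(x−y) ζ_ε(y) dy only involve values of z, ∇z, f at points of B_4. -/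
open MeasureTheory Metric
open scoped RealInnerProductSpace

/-- Mollification `u⁽ᵉ⁾ = u * ζ_ε` where `ζ_ε(y) = ε⁻ᵈ ζ(y/ε)`. -/
noncomputable def mollify {d : ℕ} (ζ : EuclideanSpace ℝ (Fin d) → ℝ) (ε : ℝ)
    (u : EuclideanSpace ℝ (Fin d) → ℝ) (x : EuclideanSpace ℝ (Fin d)) : ℝ :=
  ∫ y, u (x - y) * ((ε ^ d)⁻¹ * ζ (ε⁻¹ • y))

/-- Second partial derivative `D_{ij} g` in the directions of the standard basis. -/
noncomputable def D2 {d : ℕ} (g : EuclideanSpace ℝ (Fin d) → ℝ) (i j : Fin d)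
    (x : EuclideanSpace ℝ (Fin d)) : ℝ :=
  fderiv ℝ (fun w => fderiv ℝ g w (EuclideanSpace.single j 1)) x (EuclideanSpace.single i 1)

open Filter Topology

section conjugate
variable {V : Type*} [NormedAddCommGroup V] [InnerProductSpace ℝ V]

/-- Legendre transform over a set `K`. -/
noncomputable def cj (K : Set V) (u : V → ℝ) (x : V) : ℝ :=
  sSup ((fun p => ⟪p, x⟫ - u p) '' K)

theorem cj_attained {K : Set V} (hK : IsCompact K) (hne : K.Nonempty) {u : V → ℝ}
    (hu : Continuous u) (x : V) :
    ∃ p ∈ K, cj K u x = ⟪p, x⟫ - u p ∧ ∀ q ∈ K, ⟪q, x⟫ - u q ≤ cj K u x := by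
  have hc : ContinuousOn (fun p => ⟪p, x⟫ - u p) K := by fun_prop
  obtain ⟨p, hp, h1, h2⟩ := hK.exists_sSup_image_eq_and_ge hne hc
  exact ⟨p, hp, h1, fun q hq => by rw [cj, h1]; exact h2 q hq⟩

theorem cj_ge {K : Set V} (hK : IsCompact K) {u : V → ℝ}
    (hu : Continuous u) (x : V) {q : V} (hq : q ∈ K) : ⟪q, x⟫ - u q ≤ cj K u x := by
  obtain ⟨p, hp, h1, h2⟩ := cj_attained hK ⟨q, hq⟩ hu x
  exact h2 q hq

theorem cj_le {K : Set V} (hK : IsCompact K) (hne : K.Nonempty) {u : V → ℝ}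
    (hu : Continuous u) (x : V) {c : ℝ} (h : ∀ q ∈ K, ⟪q, x⟫ - u q ≤ c) : cj K u x ≤ c := by
  obtain ⟨p, hp, h1, h2⟩ := cj_attained hK hne hu x
  rw [h1]; exact h p hp

theorem cj_lipschitz {K : Set V} (hK : IsCompact K) (hne : K.Nonempty) {u : V → ℝ}
    (hu : Continuous u) {R : NNReal} (hR : ∀ p ∈ K, ‖p‖ ≤ R) : LipschitzWith R (cj K u) := by
  refine LipschitzWith.of_le_add_mul R fun x y => ?_
  refine cj_le hK hne hu x fun q hq => ?_
  have h1 := cj_ge hK hu y hq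
  have h2 : ⟪q, x⟫ - ⟪q, y⟫ ≤ R * dist x y := by
    rw [← inner_sub_right, dist_eq_norm]
    exact (real_inner_le_norm _ _).trans (by gcongr; exact hR q hq)
  linarith

theorem cj_convex {K : Set V} (hK : IsCompact K) (hne : K.Nonempty) {u : V → ℝ}
    (hu : Continuous u) : ConvexOn ℝ Set.univ (cj K u) := by
  refine ⟨convex_univ, fun x _ y _ a b ha hb hab => ?_⟩
  refine cj_le hK hne hu _ fun q hq => ?_
  have h1 := cj_ge hK hu x hq
  have h2 := cj_ge hK hu y hq
  rw [inner_add_right, inner_smul_right, inner_smul_right, smul_eq_mul, smul_eq_mul]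
  have : u q = a * u q + b * u q := by rw [← add_mul, hab, one_mul]
  nlinarith

theorem cj_sub_le {K : Set V} (hK : IsCompact K) (hne : K.Nonempty) {u v : V → ℝ}
    (hu : Continuous u) (hv : Continuous v) {c : ℝ} (h : ∀ p ∈ K, |u p - v p| ≤ c) (x : V) :
    |cj K u x - cj K v x| ≤ c := by
  rw [abs_le]
  constructor
  · have : cj K v x ≤ cj K u x + c := cj_le hK hne hv x fun q hq => by
      have h1 := cj_ge hK hu x hq
      have h2 := abs_le.1 (h q hq)
      linarith
    linarith
  · have : cj K u x ≤ cj K v x + c := cj_le hK hne hu x fun q hq => by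
      have h1 := cj_ge hK hv x hq
      have h2 := abs_le.1 (h q hq)
      linarith
    linarith

theorem cj_add_const {K : Set V} (hK : IsCompact K) (hne : K.Nonempty) {u : V → ℝ}
    (hu : Continuous u) (c : ℝ) (x : V) : cj K (fun p => u p + c) x = cj K u x - c := by
  have hv : Continuous (fun p => u p + c) := by fun_prop
  apply le_antisymm
  · exact cj_le hK hne hv x fun q hq => by have := cj_ge hK hu x hq; linarith
  · have : cj K u x ≤ cj K (fun p => u p + c) x + c :=
      cj_le hK hne hu x fun q hq => by have := cj_ge hK hv x hq; linarith
    linarith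

/-- subdivision argument: two functions with common subgradients differ by a constant. -/
theorem const_of_common_subgrad {P : Set V} (hP : Convex ℝ P) {w0 w1 : V → ℝ} {X : V → V}
    (h0 : ∀ p ∈ P, ∀ q ∈ P, w0 p + ⟪q - p, X p⟫ ≤ w0 q)
    (h1 : ∀ p ∈ P, ∀ q ∈ P, w1 p + ⟪q - p, X p⟫ ≤ w1 q)
    {p q : V} (hp : p ∈ P) (hq : q ∈ P) : w0 q - w1 q = w0 p - w1 p := by
  have key : ∀ a ∈ P, ∀ b ∈ P, |(w0 b - w1 b) - (w0 a - w1 a)| ≤ ⟪b - a, X b - X a⟫ := by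
    intro a ha b hb
    have e1 := h0 a ha b hb
    have e2 := h0 b hb a ha
    have e3 := h1 a ha b hb
    have e4 := h1 b hb a ha
    have e5 : ⟪a - b, X b⟫ = - ⟪b - a, X b⟫ := by rw [← inner_neg_left, neg_sub]
    rw [inner_sub_right, abs_le]
    constructor <;> linarith
  set C := ⟪q - p, X q - X p⟫ with hC
  have main : ∀ n : ℕ, 0 < n → |(w0 q - w1 q) - (w0 p - w1 p)| ≤ C / n := by
    intro n hn
    have hn' : (0:ℝ) < n := by exact_mod_cast hn
    set s : ℕ → V := fun i => p + ((i:ℝ) / n) • (q - p) with hs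
    have hsP : ∀ i ≤ n, s i ∈ P := by
      intro i hi
      apply hP.add_smul_sub_mem hp hq
      refine ⟨by positivity, ?_⟩
      rw [div_le_one hn']; exact_mod_cast hi
    have hs0 : s 0 = p := by simp [hs]
    have hsn : s n = q := by simp [hs, div_self hn'.ne']
    have hdiff : ∀ i, s (i+1) - s i = (1/n : ℝ) • (q - p) := by
      intro i
      simp only [hs, add_sub_add_left_eq_sub, ← sub_smul]
      congr 1; push_cast; field_simp; ring
    have t1 := Finset.sum_range_sub (fun i => w0 (s i) - w1 (s i)) n
    have t2 := Finset.sum_range_sub (fun i => X (s i)) n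
    simp only [hs0, hsn] at t1 t2
    rw [← t1]
    refine (Finset.abs_sum_le_sum_abs _ _).trans ?_
    calc _ ≤ ∑ i ∈ Finset.range n, ⟪(1/n : ℝ) • (q - p), X (s (i+1)) - X (s i)⟫ := by
          apply Finset.sum_le_sum
          intro i hi
          rw [← hdiff i]
          have := Finset.mem_range.1 hi
          exact key _ (hsP i (by omega)) _ (hsP (i+1) (by omega))
      _ = C / n := by
          rw [← inner_sum, t2, inner_smul_left, hC]; simp; ring
  have hlim : Tendsto (fun n : ℕ => C / (n:ℝ)) atTop (𝓝 0) := tendsto_const_div_atTop_nhds_zero_nat C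
  have : |(w0 q - w1 q) - (w0 p - w1 p)| ≤ 0 := by
    refine ge_of_tendsto hlim ?_
    filter_upwards [eventually_gt_atTop 0] with n hn using main n hn
  have := abs_nonpos_iff.1 this
  linarith

end conjugate

section compactness
variable {V : Type*} [NormedAddCommGroup V] [InnerProductSpace ℝ V] [FiniteDimensional ℝ V]

theorem lip_compact (ρ : ℝ) (hρ : 0 ≤ ρ) (w : ℕ → V → ℝ) (hw : ∀ n, LipschitzWith 4 (w n))
    (h0 : ∀ n, w n 0 = 0) :
    ∃ φ : ℕ → ℕ, StrictMono φ ∧ ∃ u : V → ℝ, LipschitzWith 4 u ∧ u 0 = 0 ∧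
      TendstoUniformlyOn (fun n => w (φ n)) u atTop (closedBall 0 ρ) := by
  let P := closedBall (0:V) ρ
  have : CompactSpace P := isCompact_iff_compactSpace.1 (isCompact_closedBall _ _)
  let z0 : P := ⟨0, mem_closedBall_self hρ⟩
  let W : ℕ → BoundedContinuousFunction P ℝ := fun n =>
    BoundedContinuousFunction.mkOfCompact ⟨fun p => w n p, (hw n).continuous.comp continuous_subtype_val⟩
  let A : Set (BoundedContinuousFunction P ℝ) := {g | LipschitzWith 4 g ∧ g z0 = 0}
  have hWA : ∀ n, W n ∈ A := fun n => ⟨by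
    intro x y
    exact hw n x y, h0 n⟩
  have hcl : IsClosed A := by
    have : A = {g | ∀ x y : P, dist (g x) (g y) ≤ 4 * dist x y} ∩ {g | g z0 = 0} := by
      ext g; simp only [A, Set.mem_ofPred_eq, Set.mem_inter_iff, lipschitzWith_iff_dist_le_mul]; rfl
    rw [this]
    apply IsClosed.inter
    · simp only [Set.ofPred_forall]
      refine isClosed_iInter fun x => isClosed_iInter fun y => isClosed_le ?_ continuous_const
      exact ((continuous_eval_const _).dist (continuous_eval_const _))
    · exact isClosed_eq (continuous_eval_const _) continuous_const
  have hcomp : IsCompact A := by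
    refine BoundedContinuousFunction.arzela_ascoli₂ (Set.Icc (-(4*ρ)) (4*ρ)) isCompact_Icc A hcl ?_ ?_
    · rintro g x ⟨hg, hg0⟩
      have := hg.dist_le_mul x z0
      rw [hg0, Real.dist_eq, sub_zero] at this
      have h2 : dist x z0 ≤ ρ := by
        exact mem_closedBall.1 x.2
      have h3 : |g x| ≤ 4 * ρ := by
        refine this.trans ?_
        simpa using h2
      exact abs_le.1 h3
    · apply LipschitzWith.uniformEquicontinuous _ (4 : NNReal) (fun g => g.2.1) |>.equicontinuous
  obtain ⟨g, hg, φ, hφ, hlim⟩ := hcomp.tendsto_subseq hWA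
  obtain ⟨u, hu, hug⟩ : ∃ u : V → ℝ, LipschitzWith 4 u ∧ ∀ p : P, u p = g p := by
    classical
    let u0 : V → ℝ := fun x => if h : x ∈ P then g ⟨x, h⟩ else 0
    have hu0 : LipschitzOnWith 4 u0 P := by
      intro x hx y hy
      simp only [u0, hx, hy, dif_pos]
      exact hg.1 ⟨x, hx⟩ ⟨y, hy⟩
    obtain ⟨u, hu, he⟩ := hu0.extend_real
    refine ⟨u, hu, fun p => ?_⟩
    rw [← he p.2]; simp [u0]
  refine ⟨φ, hφ, u, hu, ?_, ?_⟩
  · have := hug z0; rw [hg.2] at this; exact this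
  · rw [BoundedContinuousFunction.tendsto_iff_tendstoUniformly] at hlim
    rw [tendstoUniformlyOn_iff_tendstoUniformly_comp_coe]
    have e : (u ∘ (Subtype.val : P → V)) = g := funext fun p => hug p
    rw [e]; exact hlim
end compactness

section variational
variable {V : Type*} [NormedAddCommGroup V] [InnerProductSpace ℝ V] [FiniteDimensional ℝ V]
  [MeasurableSpace V] [BorelSpace V]

noncomputable def JJ (ρ : ℝ) (γ μ : Measure V) (T : V → V) (w : V → ℝ) : ℝ :=
  ∫ p, w p ∂γ + ∫ x, cj (closedBall 0 ρ) w (T x) ∂μ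

def IsMinJ (ρ : ℝ) (γ μ : Measure V) (T : V → V) (w : V → ℝ) : Prop :=
  LipschitzWith 4 w ∧ ∀ v : V → ℝ, LipschitzWith 4 v → JJ ρ γ μ T w ≤ JJ ρ γ μ T v

theorem integrable_cont_comp {ν : Measure V} [IsFiniteMeasure ν] {T : V → V} (hT : Measurable T)
    {r : ℝ} (h : ∀ᵐ x ∂ν, ‖T x‖ ≤ r) {u : V → ℝ} (hu : Continuous u) :
    Integrable (fun x => u (T x)) ν := by
  obtain ⟨C, hC⟩ := (isCompact_closedBall (0:V) r).exists_bound_of_continuousOn hu.continuousOn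
  refine Integrable.of_bound (hu.measurable.comp hT).aestronglyMeasurable C ?_
  filter_upwards [h] with x hx
  exact hC _ (by simpa using hx)

theorem integrable_cont {ν : Measure V} [IsFiniteMeasure ν]
    {r : ℝ} (h : ∀ᵐ x ∂ν, x ∈ closedBall (0:V) r) {u : V → ℝ} (hu : Continuous u) :
    Integrable u ν :=
  integrable_cont_comp (T := id) measurable_id (r := r) (by simpa using h) hu

variable {ρ : ℝ} {γ μ : Measure V} [IsFiniteMeasure γ] [IsFiniteMeasure μ] {T : V → V}

theorem cj_cont (hρ : 0 ≤ ρ) {w : V → ℝ} (hw : Continuous w) :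
    Continuous (cj (closedBall (0:V) ρ) w) := by
  have := cj_lipschitz (isCompact_closedBall (0:V) ρ) ⟨0, mem_closedBall_self hρ⟩ hw
    (R := ⟨ρ, hρ⟩) (fun p hp => mem_closedBall_zero_iff.1 hp)
  exact this.continuous

theorem JJ_sub_le (hρ : 0 ≤ ρ) (hγ : ∀ᵐ p ∂γ, p ∈ closedBall (0:V) ρ) (hT : Measurable T)
    (hμ : ∀ᵐ x ∂μ, ‖T x‖ ≤ 4) {w v : V → ℝ} (hw : Continuous w) (hv : Continuous v) {c : ℝ}
    (h : ∀ p ∈ closedBall (0:V) ρ, |w p - v p| ≤ c) :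
    |JJ ρ γ μ T w - JJ ρ γ μ T v| ≤ c * (γ.real Set.univ + μ.real Set.univ) := by
  have i1 := integrable_cont hγ hw
  have i2 := integrable_cont hγ hv
  have i3 := integrable_cont_comp hT hμ (cj_cont hρ hw)
  have i4 := integrable_cont_comp hT hμ (cj_cont hρ hv)
  have e : JJ ρ γ μ T w - JJ ρ γ μ T v = ∫ p, (w p - v p) ∂γ +
      ∫ x, (cj (closedBall 0 ρ) w (T x) - cj (closedBall 0 ρ) v (T x)) ∂μ := by
    rw [integral_sub i1 i2, integral_sub i3 i4, JJ, JJ]; ring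
  rw [e, mul_add]
  refine (abs_add_le _ _).trans (add_le_add ?_ ?_)
  · rw [← Real.norm_eq_abs]; refine norm_integral_le_of_norm_le_const ?_
    filter_upwards [hγ] with p hp using h p hp
  · rw [← Real.norm_eq_abs]; refine norm_integral_le_of_norm_le_const ?_
    filter_upwards with x
    exact cj_sub_le (isCompact_closedBall (0:V) ρ) ⟨0, mem_closedBall_self hρ⟩ hw hv h _

theorem JJ_add_const (hρ : 0 ≤ ρ) (hγ : ∀ᵐ p ∂γ, p ∈ closedBall (0:V) ρ) (hT : Measurable T)
    (hμ : ∀ᵐ x ∂μ, ‖T x‖ ≤ 4) (hm : γ.real Set.univ = μ.real Set.univ)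
    {w : V → ℝ} (hw : Continuous w) (c : ℝ) :
    JJ ρ γ μ T (fun p => w p + c) = JJ ρ γ μ T w := by
  have i1 := integrable_cont hγ hw
  have i3 := integrable_cont_comp hT hμ (cj_cont hρ hw)
  simp only [JJ, cj_add_const (isCompact_closedBall (0:V) ρ) ⟨0, mem_closedBall_self hρ⟩ hw]
  rw [integral_add i1 (integrable_const c), integral_sub i3 (integrable_const c)]
  simp [hm]

theorem lip_add_const {w : V → ℝ} (hw : LipschitzWith 4 w) (c : ℝ) :
    LipschitzWith 4 (fun p => w p + c) := by
  intro x y; simpa using hw x y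

theorem exists_isMinJ (hρ : 0 ≤ ρ) (hγ : ∀ᵐ p ∂γ, p ∈ closedBall (0:V) ρ) (hT : Measurable T)
    (hμ : ∀ᵐ x ∂μ, ‖T x‖ ≤ 4) (hm : γ.real Set.univ = μ.real Set.univ) :
    ∃ w : V → ℝ, IsMinJ ρ γ μ T w ∧ w 0 = 0 := by
  set S : Set ℝ := {r | ∃ w : V → ℝ, LipschitzWith 4 w ∧ w 0 = 0 ∧ JJ ρ γ μ T w = r} with hS
  have hne : S.Nonempty := ⟨_, fun _ => 0, by
    intro x y; simp, rfl, rfl⟩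
  have hbdd : BddBelow S := by
    refine ⟨JJ ρ γ μ T (fun _ => 0) - (4 * ρ) * (γ.real Set.univ + μ.real Set.univ), ?_⟩
    rintro r ⟨w, hw, hw0, rfl⟩
    have := JJ_sub_le hρ hγ hT hμ hw.continuous (continuous_const (y := (0:ℝ))) (c := 4 * ρ) (by
      intro p hp
      have := hw.dist_le_mul p 0
      rw [hw0, Real.dist_eq] at this
      refine this.trans ?_
      have := mem_closedBall.1 hp
      simpa using this)
    linarith [(abs_le.1 this).1]
  obtain ⟨r, -, hr, hrS⟩ := exists_seq_tendsto_sInf hne hbdd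
  choose w hw hw0 hwr using hrS
  obtain ⟨φ, hφ, u, hu, hu0, hlim⟩ := lip_compact ρ hρ w hw hw0
  have hJ : Tendsto (fun n => JJ ρ γ μ T (w (φ n))) atTop (𝓝 (JJ ρ γ μ T u)) := by
    rw [Metric.tendsto_atTop]
    intro ε hε
    set C := γ.real Set.univ + μ.real Set.univ with hC
    have hC0 : 0 ≤ C := by positivity
    rw [Metric.tendstoUniformlyOn_iff] at hlim
    obtain ⟨N, hN⟩ := eventually_atTop.1 (hlim (ε / (C + 1)) (by positivity))
    refine ⟨N, fun n hn => ?_⟩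
    have := JJ_sub_le hρ hγ hT hμ (hw (φ n)).continuous hu.continuous (c := ε / (C+1)) (by
      intro p hp
      have := hN n hn p hp
      rw [dist_comm, Real.dist_eq] at this; exact this.le)
    rw [Real.dist_eq]
    refine this.trans_lt ?_
    rw [← hC, div_mul_eq_mul_div, div_lt_iff₀ (by positivity)]
    nlinarith
  have hJ2 : JJ ρ γ μ T u = sInf S := by
    refine tendsto_nhds_unique hJ ?_
    simp only [hwr]
    exact hr.comp hφ.tendsto_atTop
  refine ⟨u, ⟨hu, fun v hv => ?_⟩, hu0⟩
  rw [hJ2, ← JJ_add_const hρ hγ hT hμ hm hv.continuous (- v 0)]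
  exact csInf_le hbdd ⟨_, lip_add_const hv _, by simp, rfl⟩

/-- lower bound of the mass of the subdifferential at atoms -/
theorem atom_le (hρ : 0 ≤ ρ) (hγ : ∀ᵐ p ∂γ, p ∈ closedBall (0:V) ρ) (hT : Measurable T)
    (hμ : ∀ᵐ x ∂μ, ‖T x‖ ≤ 4) {w : V → ℝ} (hw : IsMinJ ρ γ μ T w)
    {x0 : V} (hx0 : ‖x0‖ ≤ 4) :
    μ.real (T ⁻¹' {x0}) ≤
      γ.real {p | p ∈ closedBall (0:V) ρ ∧ cj (closedBall 0 ρ) w x0 = ⟪p, x0⟫ - w p} := by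
  set P := closedBall (0:V) ρ with hP
  have hPc : IsCompact P := isCompact_closedBall _ _
  have hPn : P.Nonempty := ⟨0, mem_closedBall_self hρ⟩
  set c := cj P w x0 with hc
  have hwc := hw.1.continuous
  set A : ℝ → Set V := fun t => {p | p ∈ P ∧ w p ≤ ⟪p, x0⟫ - c + t} with hA
  have hAcl : ∀ t, IsClosed (A t) := fun t =>
    hPc.isClosed.inter (isClosed_le hwc (by fun_prop))
  have step : ∀ t > 0, μ.real (T ⁻¹' {x0}) ≤ γ.real (A t) := by
    intro t ht
    set v : V → ℝ := fun p => max (w p) (⟪p, x0⟫ - c + t) with hv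
    have hvL : LipschitzWith 4 v := by
      have h2 : LipschitzWith 4 (fun p : V => ⟪p, x0⟫ - c + t) := by
        refine LipschitzWith.of_le_add_mul 4 fun p q => ?_
        have : ⟪p, x0⟫ - ⟪q, x0⟫ ≤ 4 * dist p q := by
          rw [← inner_sub_left, dist_eq_norm, mul_comm]
          exact (real_inner_le_norm _ _).trans (by gcongr)
        have e : ((4:NNReal):ℝ) = 4 := by norm_num
        rw [e]; linarith
      have := hw.1.max h2
      simpa using this
    have hvc := hvL.continuous
    have hJ := hw.2 v hvL
    have hcv : ∀ x, cj P v x ≤ cj P w x := fun x => cj_le hPc hPn hvc x fun q hq => by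
      have := cj_ge hPc hwc x hq
      have h2 : w q ≤ v q := le_max_left _ _
      linarith
    have hcv0 : cj P v x0 ≤ c - t := cj_le hPc hPn hvc x0 fun q hq => by
      have h2 : ⟪q, x0⟫ - c + t ≤ v q := le_max_right _ _
      linarith
    have i1 := integrable_cont hγ hwc
    have i2 := integrable_cont hγ hvc
    have i3 := integrable_cont_comp hT hμ (cj_cont hρ hwc)
    have i4 := integrable_cont_comp hT hμ (cj_cont hρ hvc)
    have m1 : MeasurableSet (T ⁻¹' {x0}) := hT (measurableSet_singleton _)
    have b1 : ∫ p, v p ∂γ - ∫ p, w p ∂γ ≤ t * γ.real (A t) := by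
      rw [← integral_sub i2 i1]
      calc ∫ p, (v p - w p) ∂γ ≤ ∫ p, (A t).indicator (fun _ => t) p ∂γ := by
            apply integral_mono_ae (i2.sub i1) ((integrable_const t).indicator (hAcl t).measurableSet)
            filter_upwards [hγ] with p hp
            by_cases hpA : p ∈ A t
            · simp only [hpA, Set.indicator_of_mem]
              have h1 : ⟪p, x0⟫ - w p ≤ c := cj_ge hPc hwc x0 hp
              have h2 : v p ≤ w p + t := max_le (by linarith) (by linarith)
              simp only [Pi.sub_apply]
              linarith
            · simp only [hpA, not_false_eq_true, Set.indicator_of_notMem]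
              have : ¬ (w p ≤ ⟪p, x0⟫ - c + t) := fun h => hpA ⟨hp, h⟩
              have : v p = w p := max_eq_left (by linarith)
              simp [this]
        _ = t * γ.real (A t) := by
            rw [integral_indicator (hAcl t).measurableSet]; simp [mul_comm]
    have b2 : ∫ x, cj P v (T x) ∂μ - ∫ x, cj P w (T x) ∂μ ≤ - (t * μ.real (T ⁻¹' {x0})) := by
      rw [← integral_sub i4 i3]
      calc ∫ x, (cj P v (T x) - cj P w (T x)) ∂μ
          ≤ ∫ x, (T ⁻¹' {x0}).indicator (fun _ => -t) x ∂μ := by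
            apply integral_mono (i4.sub i3) ((integrable_const (-t)).indicator m1)
            intro x
            by_cases hx : x ∈ T ⁻¹' {x0}
            · simp only [hx, Set.indicator_of_mem, Pi.sub_apply]
              have : T x = x0 := hx
              rw [this]; linarith
            · simp only [hx, not_false_eq_true, Set.indicator_of_notMem, Pi.sub_apply]
              linarith [hcv (T x)]
        _ = - (t * μ.real (T ⁻¹' {x0})) := by
            rw [integral_indicator m1]; simp [mul_comm]
    have h3 : t * μ.real (T ⁻¹' {x0}) ≤ t * γ.real (A t) := by
      have : ∫ p, w p ∂γ + ∫ x, cj P w (T x) ∂μ ≤ ∫ p, v p ∂γ + ∫ x, cj P v (T x) ∂μ := hJ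
      linarith
    exact le_of_mul_le_mul_left h3 ht
  -- limit t → 0
  have hlim : Tendsto (fun n : ℕ => γ.real (A (1 / ((n:ℝ) + 1)))) atTop
      (𝓝 (γ.real (⋂ n : ℕ, A (1 / ((n:ℝ) + 1))))) := by
    have := tendsto_measure_iInter_atTop (μ := γ) (s := fun n : ℕ => A (1 / ((n:ℝ) + 1)))
      (fun n => (hAcl _).measurableSet.nullMeasurableSet) (by
        intro m n hmn p hp
        refine ⟨hp.1, hp.2.trans ?_⟩
        have : 1 / ((n:ℝ) + 1) ≤ 1 / ((m:ℝ) + 1) := by gcongr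
        linarith) ⟨0, measure_ne_top _ _⟩
    exact (ENNReal.tendsto_toReal (measure_ne_top _ _)).comp this
  have h4 : μ.real (T ⁻¹' {x0}) ≤ γ.real (⋂ n : ℕ, A (1 / ((n:ℝ) + 1))) :=
    ge_of_tendsto' hlim fun n => step _ (by positivity)
  refine h4.trans (measureReal_mono ?_)
  intro p hp
  rw [Set.mem_iInter] at hp
  have hp0 := (hp 0).1
  refine ⟨hp0, le_antisymm ?_ (cj_ge hPc hwc x0 hp0)⟩
  have h5 : Tendsto (fun n : ℕ => ⟪p, x0⟫ - c + 1 / ((n:ℝ) + 1)) atTop (𝓝 (⟪p, x0⟫ - c + 0)) :=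
    tendsto_const_nhds.add tendsto_one_div_add_atTop_nhds_zero_nat
  have := ge_of_tendsto' h5 fun n => (hp n).2
  linarith

/-- uniqueness of the minimizer -/
theorem isMinJ_unique (hρ : 0 ≤ ρ) (hγ : ∀ᵐ p ∂γ, p ∈ closedBall (0:V) ρ)
    (hpos : ∀ U : Set V, IsOpen U → (U ∩ closedBall 0 ρ).Nonempty → γ U ≠ 0)
    (hμ : ∀ᵐ x ∂μ, ‖x‖ ≤ 4) {w0 w1 : V → ℝ} (h0 : IsMinJ ρ γ μ id w0) (h1 : IsMinJ ρ γ μ id w1)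
    (h00 : w0 0 = 0) (h10 : w1 0 = 0) : ∀ p ∈ closedBall (0:V) ρ, w0 p = w1 p := by
  set P := closedBall (0:V) ρ with hP
  have hPc : IsCompact P := isCompact_closedBall _ _
  have hPn : P.Nonempty := ⟨0, mem_closedBall_self hρ⟩
  set X := closedBall (0:V) 4 with hX
  have hXc : IsCompact X := isCompact_closedBall _ _
  have hXn : X.Nonempty := ⟨0, mem_closedBall_self (by norm_num)⟩
  have c0 := h0.1.continuous
  have c1 := h1.1.continuous
  have hz0 := cj_cont hρ c0
  have hz1 := cj_cont hρ c1
  set z : V → ℝ := fun x => (cj P w0 x + cj P w1 x) / 2 with hz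
  have hzc : Continuous z := by fun_prop
  set v := cj X z with hv
  have hvL : LipschitzWith 4 v := cj_lipschitz hXc hXn hzc (fun x hx => by simpa [hX] using hx)
  have hvc := hvL.continuous
  have hvle : ∀ p ∈ P, v p ≤ (w0 p + w1 p) / 2 := fun p hp =>
    cj_le hXc hXn hzc p fun x _ => by
      have e0 := cj_ge hPc c0 x hp
      have e1 := cj_ge hPc c1 x hp
      simp only [hz]
      rw [real_inner_comm]; linarith
  have hvz : ∀ x ∈ X, cj P v x ≤ z x := fun x hx => cj_le hPc hPn hvc x fun p _ => by
    have := cj_ge hXc hzc p hx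
    rw [real_inner_comm] at this; linarith
  have hμ' : ∀ᵐ x ∂μ, ‖(id x : V)‖ ≤ 4 := hμ
  have i1 := integrable_cont hγ c0
  have i2 := integrable_cont hγ c1
  have i3 := integrable_cont_comp measurable_id hμ' hz0
  have i4 := integrable_cont_comp measurable_id hμ' hz1
  have i5 := integrable_cont hγ hvc
  have i6 := integrable_cont_comp measurable_id hμ' (cj_cont hρ hvc)
  have i7 := integrable_cont_comp measurable_id hμ' hzc
  have b1 : ∫ x, cj P v (id x) ∂μ ≤ ∫ x, z (id x) ∂μ := by
    apply integral_mono_ae i6 i7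
    filter_upwards [hμ] with x hx
    exact hvz x (by simpa [hX] using hx)
  have b2 : ∫ x, z (id x) ∂μ = (∫ x, cj P w0 (id x) ∂μ + ∫ x, cj P w1 (id x) ∂μ) / 2 := by
    rw [← integral_add i3 i4, ← integral_div]
  have b3 : ∫ p, ((w0 p + w1 p)/2 - v p) ∂γ = (∫ p, w0 p ∂γ + ∫ p, w1 p ∂γ)/2 - ∫ p, v p ∂γ := by
    have i8 : Integrable (fun p => (w0 p + w1 p)/2) γ := (i1.add i2).div_const 2
    rw [integral_sub i8 i5, ← integral_add i1 i2, ← integral_div]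
  have e0 : ∫ p, w0 p ∂γ + ∫ x, cj P w0 (id x) ∂μ ≤ ∫ p, v p ∂γ + ∫ x, cj P v (id x) ∂μ := h0.2 v hvL
  have e1 : ∫ p, w1 p ∂γ + ∫ x, cj P w1 (id x) ∂μ ≤ ∫ p, v p ∂γ + ∫ x, cj P v (id x) ∂μ := h1.2 v hvL
  have hnn : 0 ≤ᵐ[γ] fun p => (w0 p + w1 p)/2 - v p := by
    filter_upwards [hγ] with p hp
    have := hvle p hp
    simp only [Pi.zero_apply]; linarith
  have hzero : ∫ p, ((w0 p + w1 p)/2 - v p) ∂γ = 0 :=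
    le_antisymm (by linarith) (integral_nonneg_of_ae hnn)
  have hae := (integral_eq_zero_iff_of_nonneg_ae hnn (((i1.add i2).div_const 2).sub i5)).1 hzero
  have hev : ∀ p ∈ P, v p = (w0 p + w1 p) / 2 := by
    intro p hp
    by_contra hne
    set U : Set V := {q | v q ≠ (w0 q + w1 q)/2} with hU
    have hUo : IsOpen U := isOpen_ne_fun hvc (by fun_prop)
    apply hpos U hUo ⟨p, hne, hp⟩
    have : ∀ᵐ q ∂γ, q ∉ U := by
      filter_upwards [hae] with q hq
      simp only [Pi.zero_apply] at hq
      simp only [hU, Set.mem_ofPred_eq, not_not]; linarith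
    simpa [ae_iff] using this
  have hcommon : ∀ p, p ∈ P → ∃ x : V, (∀ q ∈ P, w0 p + ⟪q - p, x⟫ ≤ w0 q) ∧
      (∀ q ∈ P, w1 p + ⟪q - p, x⟫ ≤ w1 q) := by
    intro p hp
    obtain ⟨x, hx, hx1, -⟩ := cj_attained hXc hXn hzc p
    have hvp := hev p hp
    rw [hv, hx1, real_inner_comm] at hvp
    simp only [hz] at hvp
    have d0 := cj_ge hPc c0 x hp
    have d1 := cj_ge hPc c1 x hp
    refine ⟨x, fun q hq => ?_, fun q hq => ?_⟩
    · have := cj_ge hPc c0 x hq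
      rw [inner_sub_left]; linarith
    · have := cj_ge hPc c1 x hq
      rw [inner_sub_left]; linarith
  choose! Xf hX0 hX1 using hcommon
  intro p hp
  have := const_of_common_subgrad (convex_closedBall (0:V) ρ) (w0 := w0) (w1 := w1) (X := Xf)
    hX0 hX1 (mem_closedBall_self hρ) hp
  rw [h00, h10] at this
  linarith

/-- convergence of minimizers -/
theorem isMinJ_tendsto (hρ : 0 ≤ ρ) (hγ : ∀ᵐ p ∂γ, p ∈ closedBall (0:V) ρ)
    (hpos : ∀ U : Set V, IsOpen U → (U ∩ closedBall 0 ρ).Nonempty → γ U ≠ 0)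
    (hμ : ∀ᵐ x ∂μ, ‖x‖ ≤ 4) {w0 : V → ℝ} (h0 : IsMinJ ρ γ μ id w0) (h00 : w0 0 = 0)
    {T : ℕ → V → V} (hT : ∀ n, Measurable (T n)) (hTμ : ∀ n, ∀ᵐ x ∂μ, ‖T n x‖ ≤ 4)
    {r : ℕ → ℝ} (hr : Tendsto r atTop (𝓝 0)) (hTr : ∀ n x, ‖T n x - x‖ ≤ r n)
    {w : ℕ → V → ℝ} (hw : ∀ n, IsMinJ ρ γ μ (T n) (w n)) (hw0 : ∀ n, w n 0 = 0) :
    ∃ φ : ℕ → ℕ, StrictMono φ ∧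
      TendstoUniformlyOn (fun n => w (φ n)) w0 atTop (closedBall 0 ρ) := by
  obtain ⟨φ, hφ, u, hu, hu0, hlim⟩ := lip_compact ρ hρ w (fun n => (hw n).1) hw0
  have hμ' : ∀ᵐ x ∂μ, ‖(id x : V)‖ ≤ 4 := hμ
  -- J_T close to J_id
  have hclose : ∀ n, ∀ v : V → ℝ, Continuous v →
      |JJ ρ γ μ (T n) v - JJ ρ γ μ id v| ≤ ρ * r n * μ.real Set.univ := by
    intro n v hv
    have i3 := integrable_cont_comp (hT n) (hTμ n) (cj_cont hρ hv)
    have i4 := integrable_cont_comp measurable_id hμ' (cj_cont hρ hv)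
    have e : JJ ρ γ μ (T n) v - JJ ρ γ μ id v =
        ∫ x, (cj (closedBall 0 ρ) v (T n x) - cj (closedBall 0 ρ) v (id x)) ∂μ := by
      rw [integral_sub i3 i4, JJ, JJ]; ring
    rw [e]
    rw [← Real.norm_eq_abs]; refine norm_integral_le_of_norm_le_const ?_
    filter_upwards with x
    have hL := cj_lipschitz (isCompact_closedBall (0:V) ρ) ⟨0, mem_closedBall_self hρ⟩ hv
      (R := ⟨ρ, hρ⟩) (fun p hp => mem_closedBall_zero_iff.1 hp)
    have := hL.dist_le_mul (T n x) x
    rw [dist_eq_norm, dist_eq_norm] at this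
    exact this.trans (mul_le_mul_of_nonneg_left (hTr n x) hρ)
  have humin : IsMinJ ρ γ μ id u := by
    refine ⟨hu, fun v hv => ?_⟩
    set C := γ.real Set.univ + μ.real Set.univ with hC
    have hC0 : 0 ≤ C := by positivity
    refine le_of_forall_pos_le_add fun ε hε => ?_
    rw [Metric.tendstoUniformlyOn_iff] at hlim
    have ev1 := hlim (ε / 2 / (C + 1)) (by positivity)
    have ht : Tendsto (fun n => 2 * (ρ * r (φ n) * μ.real Set.univ)) atTop (𝓝 0) := by
      have := (((hr.comp hφ.tendsto_atTop).const_mul ρ).mul_const (μ.real Set.univ)).const_mul 2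
      simpa using this
    have ev2 := ht.eventually (gt_mem_nhds (half_pos hε))
    obtain ⟨n, hn1, hn2⟩ := (ev1.and ev2).exists
    have a1 := JJ_sub_le hρ hγ measurable_id hμ' (hw (φ n)).1.continuous hu.continuous
      (c := ε / 2 / (C+1)) (by
      intro p hp
      have := hn1 p hp
      rw [dist_comm, Real.dist_eq] at this; exact this.le)
    have a2 := hclose (φ n) _ (hw (φ n)).1.continuous
    have a3 := hclose (φ n) v hv.continuous
    have a4 := (hw (φ n)).2 v hv
    have a5 : ε / 2 / (C+1) * C ≤ ε / 2 := by
      rw [div_mul_eq_mul_div, div_le_iff₀ (by positivity)]; nlinarith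
    rw [← hC] at a1
    have := abs_le.1 a1
    have := abs_le.1 a2
    have := abs_le.1 a3
    linarith
  refine ⟨φ, hφ, ?_⟩
  exact hlim.congr_right (fun p hp => isMinJ_unique hρ hγ hpos hμ humin h0 hu0 h00 p hp)

end variational

section lattice
variable {d : ℕ}

theorem volume_preimage_mulVec (M : Matrix (Fin d) (Fin d) ℝ) (hM : M.det ≠ 0)
    (S : Set (Fin d → ℝ)) (hS : MeasurableSet S) :
    volume ((fun p : EuclideanSpace ℝ (Fin d) => M.mulVec p.ofLp) ⁻¹' S) =
      ENNReal.ofReal |M.det⁻¹| * volume S := by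
  have h1 : (fun p : EuclideanSpace ℝ (Fin d) => M.mulVec p.ofLp) ⁻¹' S =
      WithLp.ofLp ⁻¹' (Matrix.toLin' M ⁻¹' S) := by
    ext p; simp [Matrix.toLin'_apply]
  have hmeas : MeasurableSet (Matrix.toLin' M ⁻¹' S) :=
    (LinearMap.continuous_of_finiteDimensional (Matrix.toLin' M)).measurable hS
  rw [h1, (PiLp.volume_preserving_ofLp (Fin d)).measure_preimage hmeas.nullMeasurableSet,
    Measure.addHaar_preimage_linearMap, LinearMap.det_toLin']
  rwa [LinearMap.det_toLin']

noncomputable def bvec (B : Matrix (Fin d) (Fin d) ℝ) (k : Fin d) : EuclideanSpace ℝ (Fin d) :=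
  WithLp.toLp 2 (B k)

theorem inner_bvec (B : Matrix (Fin d) (Fin d) ℝ) (k : Fin d) (p : EuclideanSpace ℝ (Fin d)) :
    ⟪p, bvec B k⟫ = (B.mulVec p.ofLp) k := by
  simp [bvec, Matrix.mulVec, dotProduct, PiLp.inner_apply]

/-- box volume bound -/
theorem volume_box_le (B : Matrix (Fin d) (Fin d) ℝ) (hB : B.det ≠ 0) (α β : Fin d → ℝ)
    (A : Set (EuclideanSpace ℝ (Fin d)))
    (hA : ∀ p ∈ A, ∀ k, α k ≤ ⟪p, bvec B k⟫ ∧ ⟪p, bvec B k⟫ ≤ β k) (hαβ : ∀ k, α k ≤ β k) :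
    volume A ≤ ENNReal.ofReal ((∏ k, (β k - α k)) / |B.det|) := by
  have h1 : A ⊆ (fun p : EuclideanSpace ℝ (Fin d) => B.mulVec p.ofLp) ⁻¹' (Set.Icc α β) := by
    intro p hp
    refine ⟨fun k => ?_, fun k => ?_⟩
    · have := (hA p hp k).1; rwa [inner_bvec] at this
    · have := (hA p hp k).2; rwa [inner_bvec] at this
  refine (measure_mono h1).trans ?_
  rw [volume_preimage_mulVec B hB _ measurableSet_Icc, Real.volume_Icc_pi,
    ← ENNReal.ofReal_prod_of_nonneg (fun k _ => sub_nonneg.2 (hαβ k)),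
    ← ENNReal.ofReal_mul (abs_nonneg _), abs_inv, div_eq_inv_mul]

noncomputable def crd (B : Matrix (Fin d) (Fin d) ℝ) (y : EuclideanSpace ℝ (Fin d)) : Fin d → ℝ :=
  (B.transpose⁻¹).mulVec y.ofLp

noncomputable def latt (B : Matrix (Fin d) (Fin d) ℝ) (y : EuclideanSpace ℝ (Fin d)) :
    EuclideanSpace ℝ (Fin d) :=
  ∑ k, (⌊crd B y k⌋ : ℝ) • bvec B k

theorem sum_bvec (B : Matrix (Fin d) (Fin d) ℝ) (c : Fin d → ℝ) :
    ∑ k, c k • bvec B k = WithLp.toLp 2 (B.transpose.mulVec c) := by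
  ext i
  simp [bvec, Matrix.mulVec, dotProduct, mul_comm, Finset.sum_apply]

theorem crd_sum (B : Matrix (Fin d) (Fin d) ℝ) (hB : B.det ≠ 0) (c : Fin d → ℝ) :
    crd B (∑ k, c k • bvec B k) = c := by
  have : IsUnit B.transpose.det := by rw [Matrix.det_transpose]; exact isUnit_iff_ne_zero.2 hB
  rw [sum_bvec, crd, Matrix.mulVec_mulVec, Matrix.nonsing_inv_mul _ this, Matrix.one_mulVec]

theorem sum_crd (B : Matrix (Fin d) (Fin d) ℝ) (hB : B.det ≠ 0) (y : EuclideanSpace ℝ (Fin d)) :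
    ∑ k, crd B y k • bvec B k = y := by
  have : IsUnit B.transpose.det := by rw [Matrix.det_transpose]; exact isUnit_iff_ne_zero.2 hB
  rw [sum_bvec, crd, Matrix.mulVec_mulVec, Matrix.mul_nonsing_inv _ this, Matrix.one_mulVec]

theorem crd_add (B : Matrix (Fin d) (Fin d) ℝ) (x y : EuclideanSpace ℝ (Fin d)) :
    crd B (x + y) = crd B x + crd B y := by
  simp [crd, Matrix.mulVec_add]

theorem crd_continuous (B : Matrix (Fin d) (Fin d) ℝ) : Continuous (crd B) := by
  unfold crd; fun_prop

theorem latt_measurable (B : Matrix (Fin d) (Fin d) ℝ) : Measurable (latt B) := by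
  unfold latt
  refine Finset.measurable_fun_sum _ fun k _ => ?_
  have h : Measurable fun y => crd B y k := ((continuous_apply k).comp (crd_continuous B)).measurable
  have h2 : Measurable fun y => (⌊crd B y k⌋ : ℝ) := by
    exact (measurable_from_top (f := fun n : ℤ => (n:ℝ))).comp h.floor
  exact h2.smul_const _

theorem latt_sub_le (B : Matrix (Fin d) (Fin d) ℝ) (hB : B.det ≠ 0) (y : EuclideanSpace ℝ (Fin d)) :
    ‖latt B y - y‖ ≤ ∑ k, ‖bvec B k‖ := by
  nth_rewrite 2 [← sum_crd B hB y]
  rw [latt, ← Finset.sum_sub_distrib]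
  refine (norm_sum_le _ _).trans (Finset.sum_le_sum fun k _ => ?_)
  rw [← sub_smul, norm_smul]
  have h1 := Int.floor_le (crd B y k)
  have h2 := Int.lt_floor_add_one (crd B y k)
  have : ‖(⌊crd B y k⌋ : ℝ) - crd B y k‖ ≤ 1 := by
    rw [Real.norm_eq_abs, abs_le]; constructor <;> linarith
  nlinarith [norm_nonneg (bvec B k)]

theorem latt_add (B : Matrix (Fin d) (Fin d) ℝ) (hB : B.det ≠ 0) (y : EuclideanSpace ℝ (Fin d))
    (k : Fin d) : latt B (y + bvec B k) = latt B y + bvec B k := by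
  have e : bvec B k = ∑ j, (Pi.single k (1:ℝ) : Fin d → ℝ) j • bvec B j := by
    simp [Pi.single_apply]
  have h : crd B (bvec B k) = Pi.single k (1:ℝ) := by
    conv_lhs => rw [e]
    exact crd_sum B hB _
  have hf : ∀ j, (⌊crd B (y + bvec B k) j⌋ : ℝ) = ⌊crd B y j⌋ + (Pi.single k (1:ℝ) : Fin d → ℝ) j := by
    intro j
    rw [crd_add, h, Pi.add_apply]
    by_cases hj : j = k
    · subst hj; simp
    · simp [hj]
  simp only [latt, hf, add_smul, Finset.sum_add_distrib]
  rw [← e]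

theorem latt_sub (B : Matrix (Fin d) (Fin d) ℝ) (hB : B.det ≠ 0) (y : EuclideanSpace ℝ (Fin d))
    (k : Fin d) : latt B (y - bvec B k) = latt B y - bvec B k := by
  have := latt_add B hB (y - bvec B k) k
  rw [sub_add_cancel] at this
  rw [this, add_sub_cancel_right]

/-- cells -/
noncomputable def cell (B : Matrix (Fin d) (Fin d) ℝ) (n : Fin d → ℤ) : Set (EuclideanSpace ℝ (Fin d)) :=
  {y | ∀ k, ⌊crd B y k⌋ = n k}

noncomputable def lpt (B : Matrix (Fin d) (Fin d) ℝ) (n : Fin d → ℤ) : EuclideanSpace ℝ (Fin d) :=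
  ∑ k, (n k : ℝ) • bvec B k

theorem latt_of_mem_cell {B : Matrix (Fin d) (Fin d) ℝ} {n : Fin d → ℤ}
    {y : EuclideanSpace ℝ (Fin d)} (hy : y ∈ cell B n) : latt B y = lpt B n := by
  simp only [latt, lpt]
  refine Finset.sum_congr rfl fun k _ => by rw [hy k]

theorem cell_eq_preimage (B : Matrix (Fin d) (Fin d) ℝ) (hB : B.det ≠ 0) (n : Fin d → ℤ) :
    cell B n = latt B ⁻¹' {lpt B n} := by
  ext y
  refine ⟨fun hy => latt_of_mem_cell hy, fun hy k => ?_⟩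
  have : crd B (latt B y) = crd B (lpt B n) := by rw [show latt B y = lpt B n from hy]
  rw [latt, lpt, crd_sum B hB, crd_sum B hB (fun k => (n k : ℝ))] at this
  exact_mod_cast congrFun this k

theorem cell_measurable (B : Matrix (Fin d) (Fin d) ℝ) (hB : B.det ≠ 0) (n : Fin d → ℤ) :
    MeasurableSet (cell B n) := by
  rw [cell_eq_preimage B hB]; exact latt_measurable B (measurableSet_singleton _)

theorem cell_volume (B : Matrix (Fin d) (Fin d) ℝ) (hB : B.det ≠ 0) (n : Fin d → ℤ) :
    volume (cell B n) = ENNReal.ofReal |B.det| := by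
  have h : cell B n = (fun p : EuclideanSpace ℝ (Fin d) => (B.transpose⁻¹).mulVec p.ofLp) ⁻¹'
      (Set.univ.pi fun k => Set.Ico (n k : ℝ) (n k + 1)) := by
    ext y
    simp only [cell, Set.mem_ofPred_eq, Set.mem_preimage, Set.mem_univ_pi, Int.floor_eq_iff,
      Set.mem_Ico, crd]
  have hd : (B.transpose⁻¹).det = (B.det)⁻¹ := by
    rw [Matrix.det_nonsing_inv, Ring.inverse_eq_inv', Matrix.det_transpose]
  rw [h, volume_preimage_mulVec _ (by rw [hd]; exact inv_ne_zero hB) _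
    (MeasurableSet.univ_pi fun k => measurableSet_Ico), hd, inv_inv, volume_pi_pi]
  simp

theorem iUnion_cell (B : Matrix (Fin d) (Fin d) ℝ) : ⋃ n, cell B n = Set.univ := by
  ext y; simp only [Set.mem_iUnion, Set.mem_univ, iff_true]
  exact ⟨fun k => ⌊crd B y k⌋, fun k => rfl⟩

theorem cell_disjoint (B : Matrix (Fin d) (Fin d) ℝ) : Pairwise (Function.onFun Disjoint (cell B)) := by
  intro m n hmn
  refine Set.disjoint_left.2 fun y hm hn => hmn ?_
  funext k; rw [← hm k, ← hn k]

end lattice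

section cells
variable {d : ℕ}

noncomputable def gam (ρ θ : ℝ) : Measure (EuclideanSpace ℝ (Fin d)) :=
  (volume.restrict (closedBall 0 ρ)).withDensity
    (fun p => ENNReal.ofReal ((1 + θ * ‖p‖) ^ (-(d:ℝ))))

noncomputable def muf (f : EuclideanSpace ℝ (Fin d) → ℝ) : Measure (EuclideanSpace ℝ (Fin d)) :=
  volume.withDensity (fun x => ENNReal.ofReal (f x ^ d))

/-- second difference -/
noncomputable def sd (B : Matrix (Fin d) (Fin d) ℝ) (u : EuclideanSpace ℝ (Fin d) → ℝ)
    (x : EuclideanSpace ℝ (Fin d)) : ℝ :=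
  ∑ k, (u (x + bvec B k) + u (x - bvec B k) - 2 * u x)

theorem amgm (hd : 1 ≤ d) (a : Fin d → ℝ) (ha : ∀ k, 0 ≤ a k) :
    ∏ k, a k ≤ ((∑ k, a k) / d) ^ d := by
  have hd' : (d:ℝ) ≠ 0 := by positivity
  have h := Real.geom_mean_le_arith_mean_weighted Finset.univ (fun _ : Fin d => (1 / d : ℝ)) a
    (fun _ _ => by positivity) (by simp [hd']) (fun k _ => ha k)
  have h2 : (∏ k, a k ^ (1 / d : ℝ)) ^ d = ∏ k, a k := by
    rw [← Finset.prod_pow]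
    refine Finset.prod_congr rfl fun k _ => ?_
    rw [← Real.rpow_natCast, ← Real.rpow_mul (ha k), one_div_mul_cancel hd', Real.rpow_one]
  rw [← h2]
  have h3 : ∑ k, (1 / d : ℝ) * a k = (∑ k, a k) / d := by
    rw [← Finset.mul_sum]; ring
  rw [h3] at h
  exact pow_le_pow_left₀ (Finset.prod_nonneg fun k _ => Real.rpow_nonneg (ha k) _) h d

theorem sd_nonneg (B : Matrix (Fin d) (Fin d) ℝ) {u : EuclideanSpace ℝ (Fin d) → ℝ}
    (hu : ConvexOn ℝ Set.univ u) (x : EuclideanSpace ℝ (Fin d)) (k : Fin d) :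
    0 ≤ u (x + bvec B k) + u (x - bvec B k) - 2 * u x := by
  have h := hu.2
  have := h (Set.mem_univ (x + bvec B k)) (Set.mem_univ (x - bvec B k))
    (by norm_num : (0:ℝ) ≤ 1/2) (by norm_num : (0:ℝ) ≤ 1/2) (by norm_num)
  have e : (1/2 : ℝ) • (x + bvec B k) + (1/2 : ℝ) • (x - bvec B k) = x := by
    rw [← smul_add]; simp [← two_smul ℝ x, smul_smul]
  rw [e] at this
  simp only [smul_eq_mul] at this
  linarith

theorem gam_le (ρ θ : ℝ) (hθ : 0 ≤ θ) {q : ℝ} (hq : 0 ≤ q) (A : Set (EuclideanSpace ℝ (Fin d)))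
    (hA : MeasurableSet A) (hqA : ∀ p ∈ A, q ≤ ‖p‖) :
    gam ρ θ A ≤ ENNReal.ofReal (((1 + θ * q) ^ d)⁻¹) * volume A := by
  rw [gam, withDensity_apply _ hA]
  calc _ ≤ ∫⁻ p in A, ENNReal.ofReal (((1 + θ * q) ^ d)⁻¹) ∂(volume.restrict (closedBall 0 ρ)) := by
        refine setLIntegral_mono measurable_const fun p hp => ?_
        apply ENNReal.ofReal_le_ofReal
        have h1 := hqA p hp
        rw [Real.rpow_neg (by positivity), Real.rpow_natCast]
        gcongr
    _ ≤ _ := by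
        rw [setLIntegral_const]
        gcongr
        exact Measure.restrict_le_self

theorem cell_point (hd : 1 ≤ d) {ρ θ : ℝ} (hρ : 0 ≤ ρ) (hθ : 0 ≤ θ)
    [IsFiniteMeasure (gam (d := d) ρ θ)]
    (hγ : ∀ᵐ p ∂(gam (d := d) ρ θ), p ∈ closedBall 0 ρ)
    {μ : Measure (EuclideanSpace ℝ (Fin d))} [IsFiniteMeasure μ]
    (B : Matrix (Fin d) (Fin d) ℝ) (hB : B.det ≠ 0)
    (hμ : ∀ᵐ x ∂μ, ‖latt B x‖ ≤ 4) {w : EuclideanSpace ℝ (Fin d) → ℝ}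
    (hw : IsMinJ ρ (gam ρ θ) μ (latt B) w) {z : EuclideanSpace ℝ (Fin d) → ℝ}
    (hz : z = cj (closedBall 0 ρ) w) (n : Fin d → ℤ) {s : ℝ} (hs : 0 < s)
    {e : EuclideanSpace ℝ (Fin d)} (he : ‖e‖ ≤ 1) :
    (μ.real (cell B n) * |B.det|) *
      (1 + θ * max 0 ((z (lpt B n) - z (lpt B n - s • e)) / s)) ^ d ≤
      (sd B z (lpt B n) / d) ^ d := by
  have hPc : IsCompact (closedBall (0 : EuclideanSpace ℝ (Fin d)) ρ) := isCompact_closedBall _ _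
  have hPn : (closedBall (0 : EuclideanSpace ℝ (Fin d)) ρ).Nonempty := ⟨0, mem_closedBall_self hρ⟩
  have hwc := hw.1.continuous
  have hconv : ConvexOn ℝ Set.univ z := by rw [hz]; exact cj_convex hPc hPn hwc
  set x0 := lpt B n with hx0
  set q := max 0 ((z x0 - z (x0 - s • e)) / s) with hq
  have hq0 : 0 ≤ q := le_max_left _ _
  have hdn := fun k => sd_nonneg B hconv x0 k
  have hsd0 : 0 ≤ sd B z x0 := Finset.sum_nonneg fun k _ => hdn k
  have hV : 0 < |B.det| := abs_pos.2 hB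
  by_cases hx4 : ‖x0‖ ≤ 4
  · have h1 := atom_le hρ hγ (latt_measurable B) hμ hw hx4
    rw [← cell_eq_preimage B hB, ← hz] at h1
    set A : Set (EuclideanSpace ℝ (Fin d)) :=
      {p | p ∈ closedBall 0 ρ ∧ z x0 = ⟪p, x0⟫ - w p} with hA
    have hAm : MeasurableSet A := (hPc.isClosed.inter (isClosed_eq continuous_const
      (by fun_prop))).measurableSet
    have hsub : ∀ p ∈ A, ∀ x, z x0 + ⟪p, x - x0⟫ ≤ z x := by
      intro p hp x
      have := cj_ge hPc hwc x hp.1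
      rw [← hz] at this
      rw [inner_sub_right, hp.2]; linarith
    have hqA : ∀ p ∈ A, q ≤ ‖p‖ := by
      intro p hp
      refine max_le (norm_nonneg _) ?_
      rw [div_le_iff₀ hs]
      have := hsub p hp (x0 - s • e)
      have e1 : x0 - s • e - x0 = - (s • e) := by abel
      rw [e1, inner_neg_right, inner_smul_right] at this
      have h3 := real_inner_le_norm p e
      have h4 : ‖p‖ * ‖e‖ ≤ ‖p‖ := mul_le_of_le_one_right (norm_nonneg _) he
      nlinarith
    have hvol : volume A ≤ ENNReal.ofReal ((∏ k, (z (x0 + bvec B k) + z (x0 - bvec B k) - 2 * z x0)) / |B.det|) := by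
      have := volume_box_le B hB (fun k => z x0 - z (x0 - bvec B k)) (fun k => z (x0 + bvec B k) - z x0)
        A (fun p hp k => by
          have a1 := hsub p hp (x0 + bvec B k)
          have a2 := hsub p hp (x0 - bvec B k)
          have e1 : x0 - bvec B k - x0 = - bvec B k := by abel
          rw [add_sub_cancel_left] at a1
          rw [e1, inner_neg_right] at a2
          constructor <;> linarith) (fun k => by linarith [hdn k])
      have e5 : ∏ k, (z (x0 + bvec B k) + z (x0 - bvec B k) - 2 * z x0) =
          ∏ k, (z (x0 + bvec B k) - z x0 - (z x0 - z (x0 - bvec B k))) :=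
        Finset.prod_congr rfl fun k _ => by ring
      rw [e5]; exact this
    have hγA := gam_le ρ θ hθ hq0 A hAm hqA
    set Pr := ∏ k, (z (x0 + bvec B k) + z (x0 - bvec B k) - 2 * z x0) with hPr
    have hPr0 : 0 ≤ Pr := Finset.prod_nonneg fun k _ => hdn k
    have hQ : 0 < (1 + θ * q) ^ d := by positivity
    have h2 : (gam ρ θ).real A ≤ ((1 + θ * q) ^ d)⁻¹ * (Pr / |B.det|) := by
      refine ENNReal.toReal_le_of_le_ofReal (by positivity) ?_
      rw [ENNReal.ofReal_mul (by positivity)]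
      exact hγA.trans (by gcongr)
    have h3 := amgm hd _ hdn
    calc _ ≤ (((1 + θ * q) ^ d)⁻¹ * (Pr / |B.det|) * |B.det|) * (1 + θ * q) ^ d := by
          gcongr
          exact h1.trans h2
      _ = Pr := by field_simp
      _ ≤ _ := h3
  · have h0 : μ.real (cell B n) = 0 := by
      rw [measureReal_def, ENNReal.toReal_eq_zero_iff]; left
      refine measure_mono_null ?_ (ae_iff.1 hμ)
      intro y hy
      simp only [Set.mem_ofPred_eq]
      rw [latt_of_mem_cell hy]; exact hx4
    rw [h0, zero_mul, zero_mul]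
    positivity

theorem muf_cell {f : EuclideanSpace ℝ (Fin d) → ℝ} (hf0 : ∀ x, 0 ≤ f x)
    (hfd : Integrable (fun x => f x ^ d)) {A : Set (EuclideanSpace ℝ (Fin d))}
    (hA : MeasurableSet A) : (muf f).real A = ∫ x in A, f x ^ d := by
  rw [measureReal_def, muf, withDensity_apply _ hA,
    integral_eq_lintegral_of_nonneg_ae (ae_of_all _ fun x => pow_nonneg (hf0 x) d)
      hfd.aestronglyMeasurable.restrict]

theorem cell_int (hd : 1 ≤ d) {f : EuclideanSpace ℝ (Fin d) → ℝ}
    (hf0 : ∀ x, 0 ≤ f x) (hfi : Integrable f)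
    (hfd : Integrable (fun x => f x ^ d))
    (B : Matrix (Fin d) (Fin d) ℝ) (hB : B.det ≠ 0) (n : Fin d → ℤ)
    {Q : EuclideanSpace ℝ (Fin d) → ℝ} {S : ℝ} (hS : 0 ≤ S) (hQ0 : ∀ y, 0 ≤ Q y)
    (hfQ : Integrable fun y => f y * Q y)
    (h : ∀ y ∈ cell B n, (muf f).real (cell B n) * |B.det| * Q y ^ d ≤ S ^ d) :
    |B.det| ^ (2 / d : ℝ) * ∫ y in cell B n, f y * Q y ≤ |B.det| * S := by
  have hd' : (d:ℝ) ≠ 0 := by positivity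
  have hV : 0 < |B.det| := abs_pos.2 hB
  set V := |B.det| with hVdef
  have hcm := cell_measurable B hB n
  rw [muf_cell hf0 hfd hcm] at h
  set m := ∫ x in cell B n, f x ^ d with hm
  have hm0 : 0 ≤ m := setIntegral_nonneg hcm fun x _ => pow_nonneg (hf0 x) d
  have hvol : volume.real (cell B n) = V := by
    rw [measureReal_def, cell_volume B hB, ENNReal.toReal_ofReal hV.le]
  have hfin : volume (cell B n) ≠ ⊤ := by rw [cell_volume B hB]; exact ENNReal.ofReal_ne_top
  rcases hm0.eq_or_lt with hm1 | hm1
  · have h0 : (fun x => f x ^ d) =ᵐ[volume.restrict (cell B n)] 0 :=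
      (integral_eq_zero_iff_of_nonneg (fun x => pow_nonneg (hf0 x) d) hfd.integrableOn).1 hm1.symm
    have h1 : ∫ y in cell B n, f y * Q y = 0 := by
      apply integral_eq_zero_of_ae
      filter_upwards [h0] with y hy
      have : f y = 0 := pow_eq_zero_iff (by omega) |>.1 hy
      simp [this]
    rw [h1, mul_zero]; positivity
  · set c := (m / V) ^ (1 / d : ℝ) with hc
    have hc0 : 0 < c := Real.rpow_pos_of_pos (by positivity) _
    have hcd : c ^ d = m / V := by
      rw [hc, ← Real.rpow_natCast, ← Real.rpow_mul (by positivity), one_div_mul_cancel hd', Real.rpow_one]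
    set κ := V ^ (2 / d : ℝ) with hκ
    have hκ0 : 0 < κ := Real.rpow_pos_of_pos hV _
    have hκd : κ ^ d = V ^ 2 := by
      rw [hκ, ← Real.rpow_natCast, ← Real.rpow_mul hV.le, div_mul_cancel₀ _ hd']
      norm_num
    have hQ : ∀ y ∈ cell B n, Q y ≤ S / (c * κ) := by
      intro y hy
      rw [le_div_iff₀ (by positivity)]
      refine le_of_pow_le_pow_left₀ (by omega : d ≠ 0) hS ?_
      rw [mul_pow, mul_pow, hcd, hκd]
      refine le_trans (le_of_eq ?_) (h y hy)
      field_simp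
    have hint : ∫ y in cell B n, f y ≤ c * V := by
      have hb : ∀ y, f y ≤ c * ((f y ^ d / c ^ d - 1) / d + 1) := by
        intro y
        have h1 := one_add_mul_sub_le_pow (a := f y / c) (by
          have : 0 ≤ f y / c := div_nonneg (hf0 y) hc0.le
          linarith) d
        rw [div_pow] at h1
        have h2 : f y / c ≤ (f y ^ d / c ^ d - 1) / d + 1 := by
          rw [← sub_le_iff_le_add, le_div_iff₀ (by positivity)]
          linarith
        rw [div_le_iff₀ hc0] at h2
        linarith
      have i1 : IntegrableOn (fun y => f y ^ d / c ^ d) (cell B n) := (hfd.div_const _).integrableOn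
      have ic : ∀ a : ℝ, IntegrableOn (fun _ : EuclideanSpace ℝ (Fin d) => a) (cell B n) :=
        fun a => integrableOn_const hfin
      have i2 : IntegrableOn (fun y => f y ^ d / c ^ d - 1) (cell B n) := i1.sub (ic 1)
      have i3 : IntegrableOn (fun y => (f y ^ d / c ^ d - 1) / d) (cell B n) := i2.div_const _
      calc _ ≤ ∫ y in cell B n, c * ((f y ^ d / c ^ d - 1) / d + 1) :=
            integral_mono hfi.integrableOn ((i3.add (ic 1)).const_mul c) hb
        _ = c * V := by
            rw [integral_const_mul, integral_add i3 (ic 1), integral_div, integral_sub i1 (ic 1),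
              integral_div, hcd]
            simp only [integral_const, measureReal_restrict_apply_univ, hvol, smul_eq_mul, ← hm]
            field_simp; ring
    have h5 : ∫ y in cell B n, f y * Q y ≤ S / (c * κ) * (c * V) := by
      calc _ ≤ ∫ y in cell B n, S / (c * κ) * f y := by
            apply setIntegral_mono_on hfQ.integrableOn (hfi.const_mul _).integrableOn hcm
            intro y hy
            rw [mul_comm]
            exact mul_le_mul_of_nonneg_right (hQ y hy) (hf0 y)
        _ = S / (c * κ) * ∫ y in cell B n, f y := integral_const_mul _ _
        _ ≤ _ := by gcongr
    calc _ ≤ κ * (S / (c * κ) * (c * V)) := by gcongr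
      _ = V * S := by field_simp

theorem integrable_latt (B : Matrix (Fin d) (Fin d) ℝ) (hB : B.det ≠ 0)
    {G : EuclideanSpace ℝ (Fin d) → ℝ} (hG : Continuous G) (hGc : HasCompactSupport G) :
    Integrable (fun y => G (latt B y)) := by
  obtain ⟨C, hC⟩ := hGc.exists_bound_of_continuous hG
  obtain ⟨r, hr⟩ := hGc.isCompact.isBounded.subset_closedBall (0 : EuclideanSpace ℝ (Fin d))
  set R := r + ∑ k, ‖bvec B k‖
  have hsupp : ∀ y, y ∉ closedBall (0 : EuclideanSpace ℝ (Fin d)) R → G (latt B y) = 0 := by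
    intro y hy
    by_contra hne
    apply hy
    have h1 : latt B y ∈ closedBall (0 : EuclideanSpace ℝ (Fin d)) r :=
      hr (subset_tsupport _ hne)
    rw [mem_closedBall_zero_iff] at h1 ⊢
    have h2 := latt_sub_le B hB y
    have h3 : ‖y‖ ≤ ‖latt B y‖ + ‖latt B y - y‖ := by
      have := norm_sub_le (latt B y) (latt B y - y)
      simpa using this
    linarith
  have hi : IntegrableOn (fun y => G (latt B y)) (closedBall 0 R) := by
    refine Measure.integrableOn_of_bounded (M := C) measure_closedBall_lt_top.ne ?_ ?_
    · exact (hG.measurable.comp (latt_measurable B)).aestronglyMeasurable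
    · exact ae_of_all _ fun y => hC _
  exact (integrableOn_iff_integrable_of_support_subset (fun y hy => by
    by_contra h; exact hy (hsupp y h))).1 hi

theorem sum_by_parts (B : Matrix (Fin d) (Fin d) ℝ) (hB : B.det ≠ 0)
    {φ z : EuclideanSpace ℝ (Fin d) → ℝ} (hφ : Continuous φ) (hφc : HasCompactSupport φ)
    (hz : Continuous z) :
    ∫ y, φ (latt B y) * sd B z (latt B y) = ∫ y, z (latt B y) * sd B φ (latt B y) := by
  have sh : ∀ v : EuclideanSpace ℝ (Fin d), HasCompactSupport (fun x => φ (x + v)) := fun v =>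
    hφc.comp_homeomorph (Homeomorph.addRight v)
  have I : ∀ (v : EuclideanSpace ℝ (Fin d)) (G : EuclideanSpace ℝ (Fin d) → ℝ), Continuous G →
      Integrable (fun y => φ (latt B y + v) * G (latt B y)) := fun v G hG =>
    integrable_latt B hB (G := fun x => φ (x + v) * G x) (by fun_prop) ((sh v).mul_right)
  have I0 : ∀ (G : EuclideanSpace ℝ (Fin d) → ℝ), Continuous G →
      Integrable (fun y => φ (latt B y) * G (latt B y)) := fun G hG => by
    simpa using I 0 G hG
  have t1 : ∀ k, ∫ y, φ (latt B y) * z (latt B y + bvec B k) =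
      ∫ y, φ (latt B y + -bvec B k) * z (latt B y) := fun k => by
    rw [← integral_sub_right_eq_self _ (bvec B k)]
    simp only [latt_sub B hB, sub_add_cancel]
    simp only [sub_eq_add_neg]
  have t2 : ∀ k, ∫ y, φ (latt B y) * z (latt B y - bvec B k) =
      ∫ y, φ (latt B y + bvec B k) * z (latt B y) := fun k => by
    rw [← integral_add_right_eq_self _ (bvec B k)]
    simp only [latt_add B hB, add_sub_cancel_right]
  simp only [sd, Finset.mul_sum]
  rw [integral_finsetSum, integral_finsetSum]
  · refine Finset.sum_congr rfl fun k _ => ?_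
    have i1 := I0 (fun x => z (x + bvec B k)) (by fun_prop)
    have i2 := I0 (fun x => z (x - bvec B k)) (by fun_prop)
    have i3 := I0 (fun x => 2 * z x) (by fun_prop)
    have j1 := I (bvec B k) z hz
    have j2 := I (-bvec B k) z hz
    have e1 : ∫ y, φ (latt B y) * (z (latt B y + bvec B k) + z (latt B y - bvec B k) - 2 * z (latt B y))
        = (∫ y, φ (latt B y) * z (latt B y + bvec B k)) + (∫ y, φ (latt B y) * z (latt B y - bvec B k))
          - ∫ y, φ (latt B y) * (2 * z (latt B y)) := by
      rw [← integral_add' i1 i2, ← integral_sub (i1.add i2) i3]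
      congr 1; funext y; simp only [Pi.add_apply]; ring
    have e2 : ∫ y, z (latt B y) * (φ (latt B y + bvec B k) + φ (latt B y - bvec B k) - 2 * φ (latt B y))
        = (∫ y, φ (latt B y + bvec B k) * z (latt B y)) + (∫ y, φ (latt B y + - bvec B k) * z (latt B y))
          - ∫ y, φ (latt B y) * (2 * z (latt B y)) := by
      rw [← integral_add' j1 j2, ← integral_sub (j1.add j2) i3]
      congr 1; funext y; simp only [Pi.add_apply, sub_eq_add_neg]; ring
    rw [e1, e2, t1, t2]; ring
  · intro k _
    have := I (bvec B k) z hz |>.add (I (-bvec B k) z hz) |>.sub (I0 (fun x => 2 * z x) (by fun_prop))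
    refine this.congr (ae_of_all _ fun y => ?_)
    simp only [Pi.add_apply, Pi.sub_apply, sub_eq_add_neg]; ring
  · intro k _
    exact I0 (fun x => z (x + bvec B k) + z (x - bvec B k) - 2 * z x) (by fun_prop)

theorem integrated_ineq (hd : 1 ≤ d) {ρ θ : ℝ} (hρ : 0 ≤ ρ) (hθ : 0 ≤ θ)
    [IsFiniteMeasure (gam (d := d) ρ θ)]
    (hγ : ∀ᵐ p ∂(gam (d := d) ρ θ), p ∈ closedBall 0 ρ)
    {f : EuclideanSpace ℝ (Fin d) → ℝ} [IsFiniteMeasure (muf f)]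
    (hf0 : ∀ x, 0 ≤ f x) (hfi : Integrable f)
    (hfd : Integrable (fun x => f x ^ d))
    (B : Matrix (Fin d) (Fin d) ℝ) (hB : B.det ≠ 0)
    (hμ : ∀ᵐ x ∂(muf f), ‖latt B x‖ ≤ 4) {w : EuclideanSpace ℝ (Fin d) → ℝ}
    (hw : IsMinJ ρ (gam ρ θ) (muf f) (latt B) w) {z : EuclideanSpace ℝ (Fin d) → ℝ}
    (hz : z = cj (closedBall 0 ρ) w) {s : ℝ} (hs : 0 < s)
    {e : EuclideanSpace ℝ (Fin d) → EuclideanSpace ℝ (Fin d)} (hem : Measurable e)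
    (he : ∀ y, ‖e y‖ ≤ 1)
    {φ : EuclideanSpace ℝ (Fin d) → ℝ} (hφ : Continuous φ) (hφc : HasCompactSupport φ)
    (hφ0 : ∀ y, 0 ≤ φ y) :
    d * |B.det| ^ (2 / d : ℝ) * ∫ y, φ (latt B y) *
      (f y * (1 + θ * max 0 ((z (latt B y) - z (latt B y - s • e y)) / s))) ≤
      ∫ y, z (latt B y) * sd B φ (latt B y) := by
  have hd' : (0:ℝ) < d := by exact_mod_cast hd
  have hPc : IsCompact (closedBall (0 : EuclideanSpace ℝ (Fin d)) ρ) := isCompact_closedBall _ _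
  have hPn : (closedBall (0 : EuclideanSpace ℝ (Fin d)) ρ).Nonempty := ⟨0, mem_closedBall_self hρ⟩
  have hwc := hw.1.continuous
  have hconv : ConvexOn ℝ Set.univ z := by rw [hz]; exact cj_convex hPc hPn hwc
  have hzL : LipschitzWith ⟨ρ, hρ⟩ z := by
    rw [hz]; exact cj_lipschitz hPc hPn hwc (fun p hp => mem_closedBall_zero_iff.1 hp)
  have hzc := hzL.continuous
  have hlm := latt_measurable B
  set Q : EuclideanSpace ℝ (Fin d) → ℝ :=
    fun y => 1 + θ * max 0 ((z (latt B y) - z (latt B y - s • e y)) / s) with hQ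
  have hQm : Measurable Q := by
    have m1 : Measurable fun y => z (latt B y) := hzc.measurable.comp hlm
    have m2 : Measurable fun y => z (latt B y - s • e y) :=
      hzc.measurable.comp (hlm.sub (hem.const_smul s))
    fun_prop
  have hQ0 : ∀ y, 0 ≤ Q y := fun y => by simp only [hQ]; positivity
  have hQb : ∀ y, ‖Q y‖ ≤ 1 + θ * ρ := by
    intro y
    rw [Real.norm_of_nonneg (hQ0 y)]
    simp only [hQ]
    gcongr
    refine max_le hρ ?_
    rw [div_le_iff₀ hs]
    have := hzL.dist_le_mul (latt B y) (latt B y - s • e y)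
    rw [Real.dist_eq, dist_eq_norm, sub_sub_cancel, norm_smul, Real.norm_of_nonneg hs.le] at this
    have h2 := le_abs_self (z (latt B y) - z (latt B y - s • e y))
    have h3 : s * ‖e y‖ ≤ s := mul_le_of_le_one_right hs.le (he y)
    have h4 : ρ * (s * ‖e y‖) ≤ ρ * s := by gcongr
    exact (h2.trans this).trans h4
  have hfQ : Integrable fun y => f y * Q y :=
    hfi.mul_bdd hQm.aestronglyMeasurable (ae_of_all _ hQb)
  obtain ⟨C, hC⟩ := hφc.exists_bound_of_continuous hφ
  have iF : Integrable fun y => φ (latt B y) * (f y * Q y) :=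
    hfQ.bdd_mul (hφ.measurable.comp hlm).aestronglyMeasurable (ae_of_all _ fun y => hC _)
  have iS : Integrable fun y => φ (latt B y) * sd B z (latt B y) :=
    integrable_latt B hB (G := fun x => φ x * sd B z x) (by unfold sd; fun_prop) hφc.mul_right
  rw [← sum_by_parts B hB hφ hφc hzc, ← integral_const_mul, ← sub_nonneg,
    ← integral_sub iS (iF.const_mul _)]
  have iH : Integrable (fun y => φ (latt B y) * sd B z (latt B y) -
      d * |B.det| ^ (2 / d : ℝ) * (φ (latt B y) * (f y * Q y))) := iS.sub (iF.const_mul _)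
  rw [← setIntegral_univ, ← iUnion_cell B, integral_iUnion (fun n => cell_measurable B hB n)
    (cell_disjoint B) iH.integrableOn]
  refine tsum_nonneg fun n => ?_
  have hcm := cell_measurable B hB n
  have hsd0 : 0 ≤ sd B z (lpt B n) := Finset.sum_nonneg fun k _ => sd_nonneg B hconv _ k
  have hci := cell_int hd hf0 hfi hfd B hB n (Q := Q) (S := sd B z (lpt B n) / d) (by positivity) hQ0 hfQ
    (fun y hy => by
      have := cell_point hd hρ hθ hγ B hB hμ hw hz n hs (he y)
      simp only [hQ, latt_of_mem_cell hy]
      exact this)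
  have hvol : volume.real (cell B n) = |B.det| := by
    rw [measureReal_def, cell_volume B hB, ENNReal.toReal_ofReal (abs_nonneg _)]
  rw [setIntegral_congr_fun (g := fun y => φ (lpt B n) * sd B z (lpt B n) -
    d * |B.det| ^ (2 / d : ℝ) * (φ (lpt B n) * (f y * Q y))) hcm (fun y hy => by
      simp only [latt_of_mem_cell hy])]
  have hfin : volume (cell B n) ≠ ⊤ := by rw [cell_volume B hB]; exact ENNReal.ofReal_ne_top
  have ic : IntegrableOn (fun _ : EuclideanSpace ℝ (Fin d) => φ (lpt B n) * sd B z (lpt B n))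
    (cell B n) := integrableOn_const hfin
  have iq : IntegrableOn (fun y => d * |B.det| ^ (2 / d : ℝ) * (φ (lpt B n) * (f y * Q y)))
    (cell B n) := ((hfQ.const_mul _).const_mul _).integrableOn
  rw [integral_sub ic iq]
  simp only [integral_const_mul]
  simp only [integral_const, measureReal_restrict_apply_univ, hvol, smul_eq_mul]
  have h6 := hφ0 (lpt B n)
  have h7 : d * (|B.det| ^ (2 / d : ℝ) * ∫ y in cell B n, f y * Q y) ≤ |B.det| * sd B z (lpt B n) := by
    calc _ ≤ d * (|B.det| * (sd B z (lpt B n) / d)) := by gcongr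
      _ = _ := by field_simp
  have h8 := mul_le_mul_of_nonneg_left h7 h6
  rw [sub_nonneg]
  refine le_trans (le_of_eq ?_) (h8.trans (le_of_eq ?_)) <;> ring

end cells

section limits
variable {d : ℕ}

noncomputable def qd (φ : EuclideanSpace ℝ (Fin d) → ℝ) (v x : EuclideanSpace ℝ (Fin d)) : ℝ :=
  fderiv ℝ (fun w => fderiv ℝ φ w v) x v

theorem dirder_contDiff {φ : EuclideanSpace ℝ (Fin d) → ℝ} (hφ : ContDiff ℝ (⊤ : ℕ∞) φ)
    (v : EuclideanSpace ℝ (Fin d)) : ContDiff ℝ (⊤ : ℕ∞) (fun w => fderiv ℝ φ w v) := by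
  have h : ContDiff ℝ (⊤ : ℕ∞) (fderiv ℝ φ) := hφ.fderiv_right (by simp)
  exact h.clm_apply contDiff_const

theorem dirder_hcs {φ : EuclideanSpace ℝ (Fin d) → ℝ} (hφ : HasCompactSupport φ)
    (v : EuclideanSpace ℝ (Fin d)) : HasCompactSupport (fun w => fderiv ℝ φ w v) :=
  (hφ.fderiv ℝ).comp_left (g := fun L : EuclideanSpace ℝ (Fin d) →L[ℝ] ℝ => L v) (by simp)

theorem qd_continuous {φ : EuclideanSpace ℝ (Fin d) → ℝ} (hφ : ContDiff ℝ (⊤ : ℕ∞) φ)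
    (v : EuclideanSpace ℝ (Fin d)) : Continuous (qd φ v) :=
  (dirder_contDiff (dirder_contDiff hφ v) v).continuous

theorem qd_hcs {φ : EuclideanSpace ℝ (Fin d) → ℝ} (hφ : HasCompactSupport φ)
    (v : EuclideanSpace ℝ (Fin d)) : HasCompactSupport (qd φ v) :=
  dirder_hcs (dirder_hcs hφ v) v

theorem hasDerivAt_line {φ : EuclideanSpace ℝ (Fin d) → ℝ} (hφ : ContDiff ℝ (⊤ : ℕ∞) φ)
    (x v : EuclideanSpace ℝ (Fin d)) (t : ℝ) :
    HasDerivAt (fun t : ℝ => φ (x + t • v)) (fderiv ℝ φ (x + t • v) v) t := by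
  have h1 : HasFDerivAt φ (fderiv ℝ φ (x + t • v)) (x + t • v) :=
    (hφ.differentiable (by simp)).differentiableAt.hasFDerivAt
  have h2 : HasDerivAt (fun t : ℝ => x + t • v) v t := by
    simpa using ((hasDerivAt_id t).smul_const v).const_add x
  exact h1.comp_hasDerivAt t h2

theorem secdiff {φ : EuclideanSpace ℝ (Fin d) → ℝ} (hφ : ContDiff ℝ (⊤ : ℕ∞) φ)
    (x v : EuclideanSpace ℝ (Fin d)) {h : ℝ} (hh : 0 < h) :
    ∃ ξ : ℝ, |ξ| ≤ h ∧ φ (x + h • v) + φ (x - h • v) - 2 * φ x = h ^ 2 * qd φ v (x + ξ • v) := by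
  have hk : ∀ t : ℝ, HasDerivAt (fun t : ℝ => φ (x + t • v) + φ (x + (-t) • v))
      (fderiv ℝ φ (x + t • v) v - fderiv ℝ φ (x + (-t) • v) v) t := by
    intro t
    have h1 := hasDerivAt_line hφ x v t
    have h2 : HasDerivAt (fun t : ℝ => φ (x + (-t) • v)) (-fderiv ℝ φ (x + (-t) • v) v) t := by
      have := (hasDerivAt_line hφ x v (-t)).scomp t (hasDerivAt_neg t)
      simpa [Function.comp_def] using this
    rw [sub_eq_add_neg]
    exact h1.add h2
  have hsq : ∀ t : ℝ, HasDerivAt (fun t : ℝ => t ^ 2) (2 * t) t := fun t => by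
    simpa using hasDerivAt_pow 2 t
  obtain ⟨c, hc, hce⟩ := exists_ratio_hasDerivAt_eq_ratio_slope
    (fun t : ℝ => φ (x + t • v) + φ (x + (-t) • v)) _ hh
    (fun t _ => (hk t).continuousAt.continuousWithinAt) (fun t _ => hk t)
    (fun t : ℝ => t ^ 2) _ (fun t _ => (hsq t).continuousAt.continuousWithinAt) (fun t _ => hsq t)
  have hm : ∀ t : ℝ, HasDerivAt (fun t : ℝ => fderiv ℝ φ (x + t • v) v) (qd φ v (x + t • v)) t :=
    fun t => hasDerivAt_line (dirder_contDiff hφ v) x v t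
  obtain ⟨ξ, hξ, hξe⟩ := exists_hasDerivAt_eq_slope (fun t : ℝ => fderiv ℝ φ (x + t • v) v) _
    (show -c < c by linarith [hc.1]) (fun t _ => (hm t).continuousAt.continuousWithinAt)
    (fun t _ => hm t)
  refine ⟨ξ, abs_le.2 ⟨by linarith [hξ.1, hc.2], by linarith [hξ.2, hc.2]⟩, ?_⟩
  have hc0 := hc.1
  rw [hξe]
  simp only [zero_smul, neg_zero, add_zero] at hce
  have e : φ (x - h • v) = φ (x + (-h) • v) := by rw [neg_smul, sub_eq_add_neg]
  rw [e]
  field_simp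
  linarith

theorem bvec_smul (B : Matrix (Fin d) (Fin d) ℝ) (h : ℝ) (k : Fin d) :
    bvec (h • B) k = h • bvec B k := by
  ext i; simp [bvec]

theorem det_smul_rpow (hd : 1 ≤ d) (B : Matrix (Fin d) (Fin d) ℝ) {h : ℝ} (hh : 0 < h) :
    |(h • B).det| ^ (2 / d : ℝ) = h ^ 2 * |B.det| ^ (2 / d : ℝ) := by
  have hd' : (d:ℝ) ≠ 0 := by positivity
  rw [Matrix.det_smul, Fintype.card_fin, abs_mul, abs_of_pos (pow_pos hh d),
    Real.mul_rpow (by positivity) (abs_nonneg _)]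
  congr 1
  rw [← Real.rpow_natCast, ← Real.rpow_mul hh.le, mul_div_cancel₀ _ hd']
  norm_num

theorem limit_core (hd : 1 ≤ d) {ρ θ : ℝ} (hρ : 0 ≤ ρ) (hθ : 0 ≤ θ)
    {f : EuclideanSpace ℝ (Fin d) → ℝ} (hfi : Integrable f)
    (B : Matrix (Fin d) (Fin d) ℝ) (hB : B.det ≠ 0)
    {h : ℕ → ℝ} (hh : ∀ n, 0 < h n) (hh1 : ∀ n, h n ≤ 1) (hh0 : Tendsto h atTop (𝓝 0))
    {zn : ℕ → EuclideanSpace ℝ (Fin d) → ℝ} {Z : EuclideanSpace ℝ (Fin d) → ℝ}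
    (hzn : ∀ n, LipschitzWith ⟨ρ, hρ⟩ (zn n)) (hZ : LipschitzWith ⟨ρ, hρ⟩ Z)
    (hlim : TendstoUniformly zn Z atTop) {s : ℝ} (hs : 0 < s)
    {e : EuclideanSpace ℝ (Fin d) → EuclideanSpace ℝ (Fin d)} (hem : Measurable e)
    (he : ∀ y, ‖e y‖ ≤ 1)
    {φ : EuclideanSpace ℝ (Fin d) → ℝ} (hφ : ContDiff ℝ (⊤ : ℕ∞) φ) (hφc : HasCompactSupport φ)
    (hineq : ∀ n, d * |(h n • B).det| ^ (2 / d : ℝ) * ∫ y, φ (latt (h n • B) y) *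
      (f y * (1 + θ * max 0 ((zn n (latt (h n • B) y) - zn n (latt (h n • B) y - s • e y)) / s))) ≤
      ∫ y, zn n (latt (h n • B) y) * sd (h n • B) φ (latt (h n • B) y)) :
    d * |B.det| ^ (2 / d : ℝ) * ∫ y, φ y * (f y * (1 + θ * max 0 ((Z y - Z (y - s • e y)) / s))) ≤
      ∫ y, Z y * ∑ k, qd φ (bvec B k) y := by
  set S := ∑ k, ‖bvec B k‖ with hS
  have hS0 : 0 ≤ S := Finset.sum_nonneg fun k _ => norm_nonneg _
  have hdet : ∀ n, (h n • B).det ≠ 0 := fun n => by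
    rw [Matrix.det_smul]; exact mul_ne_zero (pow_ne_zero _ (hh n).ne') hB
  have hL : ∀ n y, ‖latt (h n • B) y - y‖ ≤ h n * S := fun n y => by
    refine (latt_sub_le _ (hdet n) y).trans (le_of_eq ?_)
    rw [hS, Finset.mul_sum]
    refine Finset.sum_congr rfl fun k _ => ?_
    rw [bvec_smul, norm_smul, Real.norm_of_nonneg (hh n).le]
  have hL1 : ∀ n y, ‖latt (h n • B) y - y‖ ≤ S := fun n y =>
    (hL n y).trans (mul_le_of_le_one_left hS0 (hh1 n))
  have hLt : ∀ y, Tendsto (fun n => latt (h n • B) y) atTop (𝓝 y) := fun y => by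
    rw [tendsto_iff_norm_sub_tendsto_zero]
    refine squeeze_zero (fun _ => norm_nonneg _) (fun n => hL n y) ?_
    simpa using hh0.mul_const S
  have hzt : ∀ y, Tendsto (fun n => zn n (latt (h n • B) y)) atTop (𝓝 (Z y)) := fun y =>
    hlim.tendsto_comp hZ.continuous.continuousAt (hLt y)
  have hzt' : ∀ y, Tendsto (fun n => zn n (latt (h n • B) y - s • e y)) atTop (𝓝 (Z (y - s • e y))) :=
    fun y => hlim.tendsto_comp hZ.continuous.continuousAt ((hLt y).sub_const _)
  obtain ⟨C, hC⟩ := hφc.exists_bound_of_continuous hφ.continuous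
  have hC0 : 0 ≤ C := (norm_nonneg _).trans (hC 0)
  -- left side
  have hleft : Tendsto (fun n => ∫ y, φ (latt (h n • B) y) *
      (f y * (1 + θ * max 0 ((zn n (latt (h n • B) y) - zn n (latt (h n • B) y - s • e y)) / s))))
      atTop (𝓝 (∫ y, φ y * (f y * (1 + θ * max 0 ((Z y - Z (y - s • e y)) / s))))) := by
    refine tendsto_integral_of_dominated_convergence (fun y => C * (‖f y‖ * (1 + θ * ρ))) ?_ ?_ ?_ ?_
    · intro n
      have hlm := latt_measurable (h n • B)
      have m1 : Measurable fun y => zn n (latt (h n • B) y) := (hzn n).continuous.measurable.comp hlm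
      have m2 : Measurable fun y => zn n (latt (h n • B) y - s • e y) :=
        (hzn n).continuous.measurable.comp (hlm.sub (hem.const_smul s))
      have m3 : Measurable fun y => φ (latt (h n • B) y) := hφ.continuous.measurable.comp hlm
      have m4 : Measurable fun y => 1 + θ * max 0 ((zn n (latt (h n • B) y) - zn n (latt (h n • B) y - s • e y)) / s) :=
        ((measurable_const.max ((m1.sub m2).div_const s)).const_mul θ).const_add 1
      exact m3.aestronglyMeasurable.mul (hfi.aestronglyMeasurable.mul m4.aestronglyMeasurable)
    · exact (hfi.norm.mul_const _).const_mul _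
    · intro n
      refine ae_of_all _ fun y => ?_
      rw [norm_mul, norm_mul]
      have hQ0 : 0 ≤ 1 + θ * max 0 ((zn n (latt (h n • B) y) - zn n (latt (h n • B) y - s • e y)) / s) := by
        positivity
      rw [Real.norm_of_nonneg hQ0]
      gcongr
      · exact hC _
      refine max_le hρ ?_
      rw [div_le_iff₀ hs]
      have := (hzn n).dist_le_mul (latt (h n • B) y) (latt (h n • B) y - s • e y)
      rw [Real.dist_eq, dist_eq_norm, sub_sub_cancel, norm_smul, Real.norm_of_nonneg hs.le] at this
      have h2 := le_abs_self (zn n (latt (h n • B) y) - zn n (latt (h n • B) y - s • e y))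
      have h3 : s * ‖e y‖ ≤ s := mul_le_of_le_one_right hs.le (he y)
      have h4 : ρ * (s * ‖e y‖) ≤ ρ * s := by gcongr
      exact (h2.trans this).trans h4
    · refine ae_of_all _ fun y => ?_
      have t1 : Tendsto (fun n => φ (latt (h n • B) y)) atTop (𝓝 (φ y)) :=
        (hφ.continuous.tendsto y).comp (hLt y)
      exact t1.mul (((((tendsto_const_nhds.max (((hzt y).sub (hzt' y)).div_const s))).const_mul θ).const_add 1).const_mul (f y))
  -- right side
  have hsd : ∀ n x, ∃ ξ : Fin d → ℝ, (∀ k, |ξ k| ≤ h n) ∧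
      (h n ^ 2)⁻¹ * sd (h n • B) φ x = ∑ k, qd φ (bvec B k) (x + ξ k • bvec B k) := by
    intro n x
    choose ξ h1 h2 using fun k => secdiff hφ x (bvec B k) (hh n)
    refine ⟨ξ, h1, ?_⟩
    have hp : h n ^ 2 ≠ 0 := pow_ne_zero _ (hh n).ne'
    rw [sd, Finset.mul_sum]
    refine Finset.sum_congr rfl fun k _ => ?_
    rw [bvec_smul, h2 k, inv_mul_cancel_left₀ hp]
  choose Ck hCk using fun k => (qd_hcs hφc (bvec B k)).exists_bound_of_continuous (qd_continuous hφ (bvec B k))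
  obtain ⟨r, hr⟩ := hφc.isCompact.isBounded.subset_closedBall (0 : EuclideanSpace ℝ (Fin d))
  have hφz : ∀ x, r < ‖x‖ → φ x = 0 := fun x hx => by
    by_contra hne
    have := hr (subset_tsupport _ hne)
    rw [mem_closedBall_zero_iff] at this
    linarith
  have hCS0 : 0 ≤ ∑ k, Ck k := Finset.sum_nonneg fun k _ => (norm_nonneg _).trans (hCk k 0)
  set R := r + 2 * S with hR
  have hright : Tendsto (fun n => ∫ y, (h n ^ 2)⁻¹ * (zn n (latt (h n • B) y) * sd (h n • B) φ (latt (h n • B) y)))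
      atTop (𝓝 (∫ y, Z y * ∑ k, qd φ (bvec B k) y)) := by
    refine tendsto_integral_filter_of_dominated_convergence
      ((closedBall (0 : EuclideanSpace ℝ (Fin d)) R).indicator
        (fun _ => (|Z 0| + 1 + ρ * (R + S)) * ∑ k, Ck k)) ?_ ?_ ?_ ?_
    · refine Eventually.of_forall fun n => ?_
      have hlm := latt_measurable (h n • B)
      have m1 : Measurable fun y => zn n (latt (h n • B) y) := (hzn n).continuous.measurable.comp hlm
      have hc := hφ.continuous
      have c2 : Continuous (sd (h n • B) φ) := by unfold sd; fun_prop
      exact ((m1.mul (c2.measurable.comp hlm)).const_mul _).aestronglyMeasurable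
    · have h0 := hlim.tendsto_comp hZ.continuous.continuousAt (tendsto_const_nhds (x := (0 : EuclideanSpace ℝ (Fin d))))
      have h1 := h0.abs.eventually (gt_mem_nhds (show |Z 0| < |Z 0| + 1 by linarith))
      filter_upwards [h1] with n hn
      refine ae_of_all _ fun y => ?_
      by_cases hy : y ∈ closedBall (0 : EuclideanSpace ℝ (Fin d)) R
      · rw [Set.indicator_of_mem hy]
        rw [mem_closedBall_zero_iff] at hy
        obtain ⟨ξ, -, h3⟩ := hsd n (latt (h n • B) y)
        rw [mul_left_comm, h3, norm_mul]
        have hn0 : 0 ≤ |Z 0| + 1 + ρ * (R + S) := by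
          have : 0 ≤ R + S := add_nonneg ((norm_nonneg _).trans hy) hS0
          positivity
        refine mul_le_mul ?_ ?_ (norm_nonneg _) hn0
        · have h4 := (hzn n).dist_le_mul (latt (h n • B) y) 0
          rw [Real.dist_eq, dist_zero_right] at h4
          have h5 : ‖latt (h n • B) y‖ ≤ R + S := by
            have := norm_add_le (latt (h n • B) y - y) y
            rw [sub_add_cancel] at this
            linarith [hL1 n y]
          have h6 : ρ * ‖latt (h n • B) y‖ ≤ ρ * (R + S) := by gcongr
          have h4' : |zn n (latt (h n • B) y) - zn n 0| ≤ ρ * ‖latt (h n • B) y‖ := h4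
          have h7 := abs_sub_abs_le_abs_sub (zn n (latt (h n • B) y)) (zn n 0)
          rw [Real.norm_eq_abs]
          linarith
        · refine (norm_sum_le _ _).trans (Finset.sum_le_sum fun k _ => hCk k _)
      · rw [Set.indicator_of_notMem hy]
        rw [mem_closedBall_zero_iff, not_le] at hy
        have h5 : r + S < ‖latt (h n • B) y‖ := by
          have := norm_sub_le (latt (h n • B) y) (latt (h n • B) y - y)
          rw [sub_sub_cancel] at this
          linarith [hL1 n y]
        have hb : ∀ k, ‖bvec (h n • B) k‖ ≤ S := fun k => by
          rw [bvec_smul, norm_smul, Real.norm_of_nonneg (hh n).le]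
          refine (mul_le_of_le_one_left (norm_nonneg _) (hh1 n)).trans ?_
          exact Finset.single_le_sum (f := fun k => ‖bvec B k‖) (fun k _ => norm_nonneg _) (Finset.mem_univ k)
        have h6 : sd (h n • B) φ (latt (h n • B) y) = 0 := by
          refine Finset.sum_eq_zero fun k _ => ?_
          rw [hφz _ (by linarith : r < ‖latt (h n • B) y‖), hφz (_ + _), hφz (_ - _)]
          · ring
          · have := norm_add_le (latt (h n • B) y - bvec (h n • B) k) (bvec (h n • B) k)
            rw [sub_add_cancel] at this
            linarith [hb k]
          · have := norm_sub_le (latt (h n • B) y + bvec (h n • B) k) (bvec (h n • B) k)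
            rw [add_sub_cancel_right] at this
            linarith [hb k]
        rw [h6]; simp
    · rw [integrable_indicator_iff measurableSet_closedBall]
      exact integrableOn_const measure_closedBall_lt_top.ne
    · refine ae_of_all _ fun y => ?_
      choose ξ h1 h2 using fun n => hsd n (latt (h n • B) y)
      have e1 : ∀ n, (h n ^ 2)⁻¹ * (zn n (latt (h n • B) y) * sd (h n • B) φ (latt (h n • B) y)) =
          zn n (latt (h n • B) y) * ∑ k, qd φ (bvec B k) (latt (h n • B) y + ξ n k • bvec B k) := fun n => by
        rw [mul_left_comm, h2]
      simp only [e1]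
      refine (hzt y).mul (tendsto_finsetSum _ fun k _ => ?_)
      refine ((qd_continuous hφ (bvec B k)).tendsto y).comp ?_
      have hx : Tendsto (fun n => ξ n k) atTop (𝓝 0) :=
        squeeze_zero_norm (fun n => h1 n k) hh0
      simpa using (hLt y).add (hx.smul_const (bvec B k))
  refine le_of_tendsto_of_tendsto' (hleft.const_mul (d * |B.det| ^ (2 / d : ℝ))) hright fun n => ?_
  have h7 := hineq n
  rw [det_smul_rpow hd B (hh n)] at h7
  rw [integral_const_mul]
  have hp : 0 < h n ^ 2 := pow_pos (hh n) 2
  rw [inv_mul_eq_div, le_div_iff₀ hp]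
  refine le_trans (le_of_eq ?_) h7
  ring

end limits

section limits2
variable {d : ℕ}

theorem limit_s (hd : 1 ≤ d) {ρ θ : ℝ} (hρ : 0 ≤ ρ) (hθ : 0 ≤ θ)
    [IsFiniteMeasure (gam (d := d) ρ θ)]
    (hγ : ∀ᵐ p ∂(gam (d := d) ρ θ), p ∈ closedBall 0 ρ)
    (hpos : ∀ U : Set (EuclideanSpace ℝ (Fin d)), IsOpen U → (U ∩ closedBall 0 ρ).Nonempty →
      gam ρ θ U ≠ 0)
    {f : EuclideanSpace ℝ (Fin d) → ℝ} [IsFiniteMeasure (muf f)]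
    (hm : (gam (d := d) ρ θ).real Set.univ = (muf f).real Set.univ)
    (hf0 : ∀ x, 0 ≤ f x) (hfi : Integrable f)
    (hfd : Integrable (fun x => f x ^ d))
    (hμ : ∀ᵐ x ∂(muf f), ‖x‖ ≤ 2) {w0 : EuclideanSpace ℝ (Fin d) → ℝ}
    (h0 : IsMinJ ρ (gam ρ θ) (muf f) id w0) (h00 : w0 0 = 0)
    {Z : EuclideanSpace ℝ (Fin d) → ℝ} (hZe : Z = cj (closedBall 0 ρ) w0)
    (B : Matrix (Fin d) (Fin d) ℝ) (hB : B.det ≠ 0) {s : ℝ} (hs : 0 < s)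
    {e : EuclideanSpace ℝ (Fin d) → EuclideanSpace ℝ (Fin d)} (hem : Measurable e)
    (he : ∀ y, ‖e y‖ ≤ 1)
    {φ : EuclideanSpace ℝ (Fin d) → ℝ} (hφ : ContDiff ℝ (⊤ : ℕ∞) φ) (hφc : HasCompactSupport φ)
    (hφ0 : ∀ y, 0 ≤ φ y) :
    d * |B.det| ^ (2 / d : ℝ) * ∫ y, φ y * (f y * (1 + θ * max 0 ((Z y - Z (y - s • e y)) / s))) ≤
      ∫ y, Z y * ∑ k, qd φ (bvec B k) y := by
  have hPc : IsCompact (closedBall (0 : EuclideanSpace ℝ (Fin d)) ρ) := isCompact_closedBall _ _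
  have hPn : (closedBall (0 : EuclideanSpace ℝ (Fin d)) ρ).Nonempty := ⟨0, mem_closedBall_self hρ⟩
  set S := ∑ k, ‖bvec B k‖ with hS
  have hS0 : 0 ≤ S := Finset.sum_nonneg fun k _ => norm_nonneg _
  set h : ℕ → ℝ := fun n => (1 + S)⁻¹ * (1 / ((n:ℝ) + 1)) with hh
  have hhp : ∀ n, 0 < h n := fun n => by simp only [hh]; positivity
  have hn1 : ∀ n : ℕ, 1 / ((n:ℝ) + 1) ≤ 1 := fun n => by
    rw [div_le_one (by positivity)]; linarith [Nat.cast_nonneg (α := ℝ) n]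
  have hhS : ∀ n, h n ≤ (1 + S)⁻¹ := fun n =>
    mul_le_of_le_one_right (by positivity) (hn1 n)
  have hh1 : ∀ n, h n ≤ 1 := fun n => (hhS n).trans (inv_le_one_of_one_le₀ (by linarith))
  have hh0 : Tendsto h atTop (𝓝 0) := by
    have := (tendsto_one_div_add_atTop_nhds_zero_nat (𝕜 := ℝ)).const_mul ((1 + S)⁻¹)
    rw [mul_zero] at this
    exact this
  have hdet : ∀ n, (h n • B).det ≠ 0 := fun n => by
    rw [Matrix.det_smul]; exact mul_ne_zero (pow_ne_zero _ (hhp n).ne') hB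
  have hL : ∀ n y, ‖latt (h n • B) y - y‖ ≤ h n * S := fun n y => by
    refine (latt_sub_le _ (hdet n) y).trans (le_of_eq ?_)
    rw [hS, Finset.mul_sum]
    refine Finset.sum_congr rfl fun k _ => ?_
    rw [bvec_smul, norm_smul, Real.norm_of_nonneg (hhp n).le]
  have hhS1 : ∀ n, h n * S ≤ 1 := fun n => by
    calc h n * S ≤ (1 + S)⁻¹ * (1 + S) := by
          have := hhS n
          gcongr; linarith
      _ = 1 := inv_mul_cancel₀ (by positivity)
  have hTμ : ∀ n, ∀ᵐ x ∂(muf f), ‖latt (h n • B) x‖ ≤ 4 := fun n => by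
    filter_upwards [hμ] with x hx
    have := norm_add_le (latt (h n • B) x - x) x
    rw [sub_add_cancel] at this
    linarith [hL n x, hhS1 n]
  have hμ4 : ∀ᵐ x ∂(muf f), ‖x‖ ≤ 4 := hμ.mono fun x hx => by linarith
  choose w hw hw0 using fun n => exists_isMinJ hρ hγ (latt_measurable (h n • B)) (hTμ n) hm
  obtain ⟨ψ, hψ, hlim⟩ := isMinJ_tendsto hρ hγ hpos hμ4 h0 h00
    (fun n => latt_measurable (h n • B)) hTμ (r := fun n => h n * S)
    (by simpa using hh0.mul_const S) hL hw hw0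
  refine limit_core hd hρ hθ hfi B hB (h := fun n => h (ψ n)) (fun n => hhp _) (fun n => hh1 _)
    (hh0.comp hψ.tendsto_atTop) (zn := fun n => cj (closedBall 0 ρ) (w (ψ n))) (Z := Z)
    ?_ ?_ ?_ hs hem he hφ hφc ?_
  · intro n
    exact cj_lipschitz hPc hPn (hw _).1.continuous (fun p hp => mem_closedBall_zero_iff.1 hp)
  · rw [hZe]
    exact cj_lipschitz hPc hPn h0.1.continuous (fun p hp => mem_closedBall_zero_iff.1 hp)
  · rw [Metric.tendstoUniformly_iff]
    intro ε hε
    filter_upwards [Metric.tendstoUniformlyOn_iff.1 hlim (ε / 2) (by positivity)] with n hn x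
    rw [hZe, Real.dist_eq]
    refine lt_of_le_of_lt (cj_sub_le hPc hPn h0.1.continuous (hw _).1.continuous
      (c := ε / 2) (fun p hp => (hn p hp).le) x) (by linarith)
  · intro n
    exact integrated_ineq hd hρ hθ hγ hf0 hfi hfd _ (hdet _) (hTμ _) (hw _) rfl hs hem he
      hφ.continuous hφc hφ0

noncomputable def ndir (Z : EuclideanSpace ℝ (Fin d) → ℝ) (y : EuclideanSpace ℝ (Fin d)) :
    EuclideanSpace ℝ (Fin d) :=
  ‖fderiv ℝ Z y‖⁻¹ • (InnerProductSpace.toDual ℝ (EuclideanSpace ℝ (Fin d))).symm (fderiv ℝ Z y)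

theorem ndir_measurable (Z : EuclideanSpace ℝ (Fin d) → ℝ) : Measurable (ndir Z) := by
  have h := measurable_fderiv ℝ Z
  have h2 : Measurable fun y =>
      (InnerProductSpace.toDual ℝ (EuclideanSpace ℝ (Fin d))).symm (fderiv ℝ Z y) :=
    (InnerProductSpace.toDual ℝ (EuclideanSpace ℝ (Fin d))).symm.continuous.measurable.comp h
  exact h.norm.inv.smul h2

theorem ndir_norm (Z : EuclideanSpace ℝ (Fin d) → ℝ) (y : EuclideanSpace ℝ (Fin d)) :
    ‖ndir Z y‖ ≤ 1 := by
  rw [ndir, norm_smul, LinearIsometryEquiv.norm_map, norm_inv, norm_norm]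
  exact inv_mul_le_one

theorem fderiv_ndir (Z : EuclideanSpace ℝ (Fin d) → ℝ) (y : EuclideanSpace ℝ (Fin d)) :
    fderiv ℝ Z y (ndir Z y) = ‖fderiv ℝ Z y‖ := by
  set g := (InnerProductSpace.toDual ℝ (EuclideanSpace ℝ (Fin d))).symm (fderiv ℝ Z y) with hg
  have h1 : fderiv ℝ Z y g = ‖g‖ * ‖g‖ := by
    have : fderiv ℝ Z y g = ⟪g, g⟫ := by
      rw [hg, InnerProductSpace.toDual_symm_apply]
    rw [this, real_inner_self_eq_norm_mul_norm]
  have h2 : ‖g‖ = ‖fderiv ℝ Z y‖ := by rw [hg, LinearIsometryEquiv.norm_map]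
  rw [ndir, map_smul, ← hg, h1, h2, smul_eq_mul]
  by_cases h : ‖fderiv ℝ Z y‖ = 0
  · rw [h]; simp
  · field_simp

theorem limit_ineq (hd : 1 ≤ d) {ρ θ : ℝ} (hρ : 0 ≤ ρ) (hθ : 0 ≤ θ)
    {f : EuclideanSpace ℝ (Fin d) → ℝ} (hfi : Integrable f)
    {Z : EuclideanSpace ℝ (Fin d) → ℝ} (hZ : LipschitzWith ⟨ρ, hρ⟩ Z)
    {φ : EuclideanSpace ℝ (Fin d) → ℝ} (hφ : Continuous φ) (hφc : HasCompactSupport φ)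
    {c M : ℝ}
    (H : ∀ s > 0, c * ∫ y, φ y * (f y * (1 + θ * max 0 ((Z y - Z (y - s • ndir Z y)) / s))) ≤ M) :
    c * ∫ y, φ y * (f y * (1 + θ * ‖fderiv ℝ Z y‖)) ≤ M := by
  obtain ⟨C, hC⟩ := hφc.exists_bound_of_continuous hφ
  have hC0 : 0 ≤ C := (norm_nonneg _).trans (hC 0)
  have hs0 : Tendsto (fun n : ℕ => 1 / ((n:ℝ) + 1)) atTop (𝓝 0) := tendsto_one_div_add_atTop_nhds_zero_nat
  have hsp : ∀ n : ℕ, 0 < 1 / ((n:ℝ) + 1) := fun n => by positivity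
  have hleft : Tendsto (fun n : ℕ => ∫ y, φ y * (f y * (1 + θ * max 0
      ((Z y - Z (y - (1 / ((n:ℝ) + 1)) • ndir Z y)) / (1 / ((n:ℝ) + 1)))))) atTop
      (𝓝 (∫ y, φ y * (f y * (1 + θ * ‖fderiv ℝ Z y‖)))) := by
    refine tendsto_integral_of_dominated_convergence (fun y => C * (‖f y‖ * (1 + θ * ρ))) ?_ ?_ ?_ ?_
    · intro n
      have m2 : Measurable fun y => Z (y - (1 / ((n:ℝ) + 1)) • ndir Z y) :=
        hZ.continuous.measurable.comp (measurable_id.sub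
          (Measurable.const_smul (g := fun y => ndir Z y) (ndir_measurable Z) (1 / ((n:ℝ) + 1))))
      have m4 : Measurable fun y => 1 + θ * max 0
          ((Z y - Z (y - (1 / ((n:ℝ) + 1)) • ndir Z y)) / (1 / ((n:ℝ) + 1))) :=
        ((measurable_const.max ((hZ.continuous.measurable.sub m2).div_const _)).const_mul θ).const_add 1
      exact hφ.aestronglyMeasurable.mul (hfi.aestronglyMeasurable.mul m4.aestronglyMeasurable)
    · exact (hfi.norm.mul_const _).const_mul _
    · intro n
      refine ae_of_all _ fun y => ?_
      have hs := hsp n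
      set s := 1 / ((n:ℝ) + 1)
      rw [norm_mul, norm_mul]
      have hQ0 : 0 ≤ 1 + θ * max 0 ((Z y - Z (y - s • ndir Z y)) / s) := by positivity
      rw [Real.norm_of_nonneg hQ0]
      gcongr
      · exact hC _
      refine max_le hρ ?_
      rw [div_le_iff₀ hs]
      have := hZ.dist_le_mul y (y - s • ndir Z y)
      rw [Real.dist_eq, dist_eq_norm, sub_sub_cancel, norm_smul, Real.norm_of_nonneg hs.le] at this
      have h2 := le_abs_self (Z y - Z (y - s • ndir Z y))
      have h3 : s * ‖ndir Z y‖ ≤ s := mul_le_of_le_one_right hs.le (ndir_norm Z y)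
      have h4 : ρ * (s * ‖ndir Z y‖) ≤ ρ * s := by gcongr
      exact (h2.trans this).trans h4
    · filter_upwards [hZ.ae_differentiableAt] with y hy
      have h1 := (hy.hasFDerivAt.hasLineDerivAt (-ndir Z y)).tendsto_slope_zero
      have h2 : Tendsto (fun n : ℕ => 1 / ((n:ℝ) + 1)) atTop (𝓝[≠] 0) :=
        tendsto_nhdsWithin_iff.2 ⟨hs0, Eventually.of_forall fun n => (hsp n).ne'⟩
      have h3 := (h1.comp h2).neg
      rw [map_neg, neg_neg, fderiv_ndir] at h3
      have h4 : Tendsto (fun n : ℕ => (Z y - Z (y - (1 / ((n:ℝ) + 1)) • ndir Z y)) / (1 / ((n:ℝ) + 1)))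
          atTop (𝓝 ‖fderiv ℝ Z y‖) := by
        refine h3.congr fun n => ?_
        simp only [Function.comp_apply, smul_neg, smul_eq_mul, ← sub_eq_add_neg]
        ring
      have h5 := (tendsto_const_nhds (x := (0:ℝ)) (f := atTop)).max h4
      rw [max_eq_right (norm_nonneg _)] at h5
      exact (((h5.const_mul θ).const_add 1).const_mul (f y)).const_mul (φ y)
  exact le_of_tendsto' (hleft.const_mul c) fun n => H _ (hsp n)

end limits2

section facts
variable {d : ℕ}

theorem gcont {θ : ℝ} (hθ : 0 ≤ θ) :
    Continuous (fun p : EuclideanSpace ℝ (Fin d) => (1 + θ * ‖p‖) ^ (-(d:ℝ))) := by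
  refine Continuous.rpow_const (by fun_prop) fun p => Or.inl ?_
  positivity

theorem gpos {θ : ℝ} (hθ : 0 ≤ θ) (p : EuclideanSpace ℝ (Fin d)) :
    0 < (1 + θ * ‖p‖) ^ (-(d:ℝ)) := Real.rpow_pos_of_pos (by positivity) _

theorem g_intOn {θ : ℝ} (hθ : 0 ≤ θ) (ρ : ℝ) : IntegrableOn
    (fun p : EuclideanSpace ℝ (Fin d) => (1 + θ * ‖p‖) ^ (-(d:ℝ))) (closedBall 0 ρ) :=
  (gcont hθ).continuousOn.integrableOn_compact (isCompact_closedBall _ _)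

theorem gam_finite {θ : ℝ} (hθ : 0 ≤ θ) (ρ : ℝ) : IsFiniteMeasure (gam (d := d) ρ θ) :=
  isFiniteMeasure_withDensity_ofReal (g_intOn hθ ρ).2

theorem gam_real {θ : ℝ} (hθ : 0 ≤ θ) (ρ : ℝ) : (gam (d := d) ρ θ).real Set.univ =
    ∫ p in closedBall (0 : EuclideanSpace ℝ (Fin d)) ρ, (1 + θ * ‖p‖) ^ (-(d : ℝ)) := by
  rw [measureReal_def, gam, withDensity_apply _ MeasurableSet.univ, Measure.restrict_univ,
    integral_eq_lintegral_of_nonneg_ae (ae_of_all _ fun p => (gpos hθ p).le)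
      (g_intOn hθ ρ).aestronglyMeasurable]

theorem gam_ae (θ ρ : ℝ) : ∀ᵐ p ∂(gam (d := d) ρ θ), p ∈ closedBall 0 ρ :=
  (withDensity_absolutelyContinuous _ _).ae_le (ae_restrict_mem measurableSet_closedBall)

theorem gam_pos {θ ρ : ℝ} (hθ : 0 ≤ θ) (hρ : 0 < ρ) (U : Set (EuclideanSpace ℝ (Fin d)))
    (hU : IsOpen U) (hne : (U ∩ closedBall 0 ρ).Nonempty) : gam ρ θ U ≠ 0 := by
  intro h
  have h1 : (volume.restrict (closedBall (0 : EuclideanSpace ℝ (Fin d)) ρ)) U = 0 := by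
    refine withDensity_absolutelyContinuous' ?_ ?_ h
    · exact (gcont hθ).measurable.ennreal_ofReal.aemeasurable
    · exact ae_of_all _ fun p => (ENNReal.ofReal_pos.2 (gpos hθ p)).ne'
  rw [Measure.restrict_apply hU.measurableSet] at h1
  obtain ⟨p, hpU, hp⟩ := hne
  rw [← closure_ball _ hρ.ne'] at hp
  have h2 : (U ∩ ball 0 ρ).Nonempty := mem_closure_iff.1 hp U hU hpU
  have h3 := (hU.inter isOpen_ball).measure_pos volume h2
  have h4 := measure_mono (μ := volume) (Set.inter_subset_inter_right U
    (ball_subset_closedBall (x := (0 : EuclideanSpace ℝ (Fin d))) (ε := ρ)))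
  rw [h1] at h4
  exact absurd (le_antisymm h4 bot_le) h3.ne'

theorem F_diff_bounds {θ : ℝ} (hθ : 0 ≤ θ) {σ ρ : ℝ} (hσ : 0 ≤ σ) (h : σ ≤ ρ) :
    ((1 + θ * ρ) ^ d)⁻¹ * ((ρ ^ d - σ ^ d) * volume.real (ball (0 : EuclideanSpace ℝ (Fin d)) 1)) ≤
    (∫ p in closedBall (0 : EuclideanSpace ℝ (Fin d)) ρ, (1 + θ * ‖p‖) ^ (-(d : ℝ))) -
      (∫ p in closedBall (0 : EuclideanSpace ℝ (Fin d)) σ, (1 + θ * ‖p‖) ^ (-(d : ℝ))) ∧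
    (∫ p in closedBall (0 : EuclideanSpace ℝ (Fin d)) ρ, (1 + θ * ‖p‖) ^ (-(d : ℝ))) -
      (∫ p in closedBall (0 : EuclideanSpace ℝ (Fin d)) σ, (1 + θ * ‖p‖) ^ (-(d : ℝ))) ≤
      (ρ ^ d - σ ^ d) * volume.real (ball (0 : EuclideanSpace ℝ (Fin d)) 1) := by
  have hρ := hσ.trans h
  have hsub : closedBall (0 : EuclideanSpace ℝ (Fin d)) σ ⊆ closedBall 0 ρ := closedBall_subset_closedBall h
  set A := closedBall (0 : EuclideanSpace ℝ (Fin d)) ρ \ closedBall 0 σ with hA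
  have hAm : MeasurableSet A := measurableSet_closedBall.diff measurableSet_closedBall
  have hfin : volume A ≠ ⊤ := ne_top_of_le_ne_top measure_closedBall_lt_top.ne
    (measure_mono Set.sdiff_subset)
  have hv : volume.real A = (ρ ^ d - σ ^ d) * volume.real (ball (0 : EuclideanSpace ℝ (Fin d)) 1) := by
    rw [hA, measureReal_diff hsub measurableSet_closedBall measure_closedBall_lt_top.ne, Measure.addHaar_real_closedBall _ _ hρ,
      Measure.addHaar_real_closedBall _ _ hσ, finrank_euclideanSpace_fin]
    ring
  rw [← setIntegral_diff measurableSet_closedBall (g_intOn hθ ρ) hsub, ← hA, ← hv]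
  have hi : IntegrableOn (fun p : EuclideanSpace ℝ (Fin d) => (1 + θ * ‖p‖) ^ (-(d:ℝ))) A :=
    (g_intOn hθ ρ).mono_set Set.sdiff_subset
  constructor
  · have : ∫ p in A, ((1 + θ * ρ) ^ d)⁻¹ = ((1 + θ * ρ) ^ d)⁻¹ * volume.real A := by
      simp [mul_comm]
    rw [← this]
    refine setIntegral_mono_on (integrableOn_const hfin) hi hAm fun p hp => ?_
    have := mem_closedBall_zero_iff.1 hp.1
    rw [Real.rpow_neg (by positivity), Real.rpow_natCast]
    gcongr
  · have : ∫ p in A, (1:ℝ) = volume.real A := by simp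
    rw [← this]
    refine setIntegral_mono_on hi (integrableOn_const hfin) hAm fun p hp => ?_
    rw [Real.rpow_neg (by positivity), Real.rpow_natCast]
    refine inv_le_one_of_one_le₀ (one_le_pow₀ ?_)
    have : 0 ≤ θ * ‖p‖ := by positivity
    linarith

theorem exists_rho (hd : 1 ≤ d) {θ : ℝ} (hθ : 0 ≤ θ) (hθ1 : θ ≤ 1) {M : ℝ} (hM : 0 ≤ M) :
    ∃ ρ, 0 ≤ ρ ∧
      ∫ p in closedBall (0 : EuclideanSpace ℝ (Fin d)) ρ, (1 + θ * ‖p‖) ^ (-(d : ℝ)) = M := by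
  set F : ℝ → ℝ := fun ρ => ∫ p in closedBall (0 : EuclideanSpace ℝ (Fin d)) ρ, (1 + θ * ‖p‖) ^ (-(d : ℝ)) with hF
  set ω := volume.real (ball (0 : EuclideanSpace ℝ (Fin d)) 1) with hω
  have hω0 : 0 < ω := ENNReal.toReal_pos (measure_ball_pos _ _ one_pos).ne' measure_ball_lt_top.ne
  have hF0 : F 0 = 0 := by
    simp only [hF]
    rw [closedBall_zero]
    haveI : Nonempty (Fin d) := ⟨⟨0, hd⟩⟩
    simp
  have hmono : ∀ σ ρ, 0 ≤ σ → σ ≤ ρ → F σ ≤ F ρ := fun σ ρ hσ h => by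
    have := (F_diff_bounds (d := d) hθ hσ h).1
    have h2 : σ ^ d ≤ ρ ^ d := by gcongr
    have h3 : 0 ≤ ((1 + θ * ρ) ^ d)⁻¹ * ((ρ ^ d - σ ^ d) * ω) := by
      have := hσ.trans h
      have := sub_nonneg.2 h2
      positivity
    simp only [hF]; linarith
  have hlip : ∀ σ ρ, 0 ≤ σ → 0 ≤ ρ → |F ρ - F σ| ≤ |ρ ^ d * ω - σ ^ d * ω| := by
    have key : ∀ σ ρ, 0 ≤ σ → σ ≤ ρ → |F ρ - F σ| ≤ |ρ ^ d * ω - σ ^ d * ω| := fun σ ρ hσ h => by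
      rw [abs_of_nonneg (sub_nonneg.2 (hmono σ ρ hσ h))]
      refine le_trans (F_diff_bounds hθ hσ h).2 ?_
      rw [sub_mul]
      exact le_abs_self _
    intro σ ρ hσ hρ
    rcases le_total σ ρ with h | h
    · exact key σ ρ hσ h
    · rw [abs_sub_comm, abs_sub_comm (ρ ^ d * ω)]; exact key ρ σ hρ h
  have hcont : ContinuousOn F (Set.Ici 0) := by
    intro σ hσ
    rw [ContinuousWithinAt, tendsto_iff_dist_tendsto_zero]
    have h2 : Tendsto (fun ρ : ℝ => |ρ ^ d * ω - σ ^ d * ω|) (𝓝[Set.Ici 0] σ) (𝓝 0) := by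
      have : Continuous (fun ρ : ℝ => |ρ ^ d * ω - σ ^ d * ω|) := by fun_prop
      have := this.tendsto σ
      rw [sub_self, abs_zero] at this
      exact this.mono_left nhdsWithin_le_nhds
    refine squeeze_zero' (Eventually.of_forall fun _ => dist_nonneg) ?_ h2
    filter_upwards [self_mem_nhdsWithin] with ρ hρ
    exact hlip σ ρ hσ hρ
  have hgrow : ∀ k : ℕ, k * ((4 ^ d)⁻¹ * ω) ≤ F (2 ^ k) := by
    intro k
    induction k with
    | zero => simpa [hF0] using hmono 0 1 le_rfl zero_le_one
    | succ k ih =>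
      have h1 := (F_diff_bounds (d := d) hθ (σ := 2 ^ k) (ρ := 2 ^ (k+1)) (by positivity)
        (pow_le_pow_right₀ (by norm_num) (by omega))).1
      have h2 : (4 ^ d)⁻¹ * ω ≤ ((1 + θ * 2 ^ (k+1)) ^ d)⁻¹ * (((2 ^ (k+1)) ^ d - (2 ^ k) ^ d) * ω) := by
        have e0 : (1:ℝ) ≤ 2 ^ k := one_le_pow₀ (by norm_num)
        have e1 : 1 + θ * 2 ^ (k+1) ≤ 4 * 2 ^ k := by
          have : θ * 2 ^ (k+1) ≤ 1 * 2 ^ (k+1) := by gcongr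
          rw [pow_succ] at this ⊢
          linarith
        have e2 : ((2:ℝ) ^ k) ^ d ≤ (2 ^ (k+1)) ^ d - (2 ^ k) ^ d := by
          rw [pow_succ, mul_pow]
          have : (2:ℝ) ≤ 2 ^ d := le_self_pow₀ (by norm_num) (by omega)
          nlinarith [pow_pos (pow_pos (show (0:ℝ) < 2 by norm_num) k) d]
        calc (4 ^ d)⁻¹ * ω = ((4 * 2 ^ k) ^ d)⁻¹ * ((2 ^ k) ^ d * ω) := by
              rw [mul_pow]; field_simp
          _ ≤ _ := by gcongr
      have h3 : F (2 ^ (k+1)) - F (2 ^ k) ≥ (4 ^ d)⁻¹ * ω := h2.trans h1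
      push_cast
      linarith
  obtain ⟨k, hk⟩ := exists_nat_ge (M / ((4 ^ d)⁻¹ * ω))
  have hkM : M ≤ F (2 ^ k) := by
    rw [div_le_iff₀ (by positivity)] at hk
    exact hk.trans (hgrow k)
  obtain ⟨ρ, hρ, hρM⟩ := intermediate_value_Icc (show (0:ℝ) ≤ 2 ^ k by positivity)
    (hcont.mono Set.Icc_subset_Ici_self) ⟨hF0.le.trans hM, hkM⟩
  exact ⟨ρ, hρ.1, hρM⟩

theorem f_facts (hd : 1 ≤ d) {f : EuclideanSpace ℝ (Fin d) → ℝ} (hf_meas : Measurable f)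
    (hf0 : ∀ x, 0 ≤ f x)
    (hf_supp : ∀ x ∉ ball (0 : EuclideanSpace ℝ (Fin d)) 2, f x = 0)
    (hf_int : IntegrableOn (fun x => f x ^ d) (ball (0 : EuclideanSpace ℝ (Fin d)) 2)) :
    Integrable f ∧ Integrable (fun x => f x ^ d) ∧ IsFiniteMeasure (muf f) ∧
    (muf f).real Set.univ = (∫ y in ball (0 : EuclideanSpace ℝ (Fin d)) 2, f y ^ d) ∧
    ∀ᵐ x ∂(muf f), ‖x‖ ≤ 2 := by
  have hsd : ∀ x ∉ ball (0 : EuclideanSpace ℝ (Fin d)) 2, f x ^ d = 0 := fun x hx => by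
    rw [hf_supp x hx, zero_pow (by omega)]
  have h2 : Integrable (fun x => f x ^ d) :=
    (integrableOn_iff_integrable_of_support_subset (fun y hy => by
      by_contra h; exact hy (hsd y h))).1 hf_int
  have h1 : IntegrableOn f (ball (0 : EuclideanSpace ℝ (Fin d)) 2) := by
    have hc : IntegrableOn (fun _ : EuclideanSpace ℝ (Fin d) => (1:ℝ)) (ball 0 2) :=
      integrableOn_const measure_ball_lt_top.ne
    refine Integrable.mono' (hc.add hf_int) hf_meas.aestronglyMeasurable (ae_of_all _ fun x => ?_)
    rw [Real.norm_of_nonneg (hf0 x)]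
    simp only [Pi.add_apply]
    rcases le_total (f x) 1 with h | h
    · linarith [pow_nonneg (hf0 x) d]
    · linarith [le_self_pow₀ h (show d ≠ 0 by omega)]
  refine ⟨(integrableOn_iff_integrable_of_support_subset (fun y hy => by
      by_contra h; exact hy (hf_supp y h))).1 h1, h2, isFiniteMeasure_withDensity_ofReal h2.2, ?_, ?_⟩
  · rw [muf_cell hf0 h2 MeasurableSet.univ, setIntegral_univ,
      setIntegral_eq_integral_of_forall_compl_eq_zero hsd]
  · rw [muf, ae_withDensity_iff (by fun_prop)]
    refine ae_of_all _ fun x hx => ?_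
    by_contra h
    apply hx
    rw [hsd x (by rw [mem_ball_zero_iff]; linarith), ENNReal.ofReal_zero]

end facts

section final
variable {d : ℕ}

theorem cv_smooth {u ψ : EuclideanSpace ℝ (Fin d) → ℝ} (hu : Continuous u)
    (hψ : ContDiff ℝ (⊤ : ℕ∞) ψ) (hψc : HasCompactSupport ψ) :
    ContDiff ℝ (⊤ : ℕ∞) (fun x => ∫ y, u y * ψ (x - y)) := by
  have := hψc.contDiff_convolution_right (ContinuousLinearMap.mul ℝ ℝ) (μ := volume)
    hu.locallyIntegrable hψ
  exact this

theorem cv_fderiv {u ψ : EuclideanSpace ℝ (Fin d) → ℝ} (hu : Continuous u)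
    (hψ : ContDiff ℝ (⊤ : ℕ∞) ψ) (hψc : HasCompactSupport ψ) (x v : EuclideanSpace ℝ (Fin d)) :
    fderiv ℝ (fun x => ∫ y, u y * ψ (x - y)) x v = ∫ y, u y * fderiv ℝ ψ (x - y) v := by
  have h1 : ContDiff ℝ 1 ψ := hψ.of_le (by simp)
  have := hψc.hasFDerivAt_convolution_right (ContinuousLinearMap.mul ℝ ℝ) (μ := volume)
    hu.locallyIntegrable h1 x
  have h2 := this.fderiv
  have h3 : fderiv ℝ (fun x => ∫ y, u y * ψ (x - y)) x = _ := h2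
  rw [h3, convolution_precompR_apply _ hu.locallyIntegrable (hψc.fderiv ℝ)
    (h1.continuous_fderiv one_ne_zero)]
  rfl

theorem cv_qd {u ψ : EuclideanSpace ℝ (Fin d) → ℝ} (hu : Continuous u)
    (hψ : ContDiff ℝ (⊤ : ℕ∞) ψ) (hψc : HasCompactSupport ψ) (x v : EuclideanSpace ℝ (Fin d)) :
    qd (fun x => ∫ y, u y * ψ (x - y)) v x = ∫ y, u y * qd ψ v (x - y) := by
  rw [qd]
  simp_rw [cv_fderiv hu hψ hψc]
  exact cv_fderiv hu (dirder_contDiff hψ v) (dirder_hcs hψc v) x v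

theorem fderiv_reflect {ψ : EuclideanSpace ℝ (Fin d) → ℝ} (hψ : ContDiff ℝ (⊤ : ℕ∞) ψ)
    (x y v : EuclideanSpace ℝ (Fin d)) :
    fderiv ℝ (fun y => ψ (x - y)) y v = -fderiv ℝ ψ (x - y) v := by
  have h1 : HasFDerivAt ψ (fderiv ℝ ψ (x - y)) (x - y) :=
    (hψ.differentiable (by simp)).differentiableAt.hasFDerivAt
  have h2 := h1.comp y ((hasFDerivAt_id y).const_sub x)
  have h3 : fderiv ℝ (fun y => ψ (x - y)) y = _ := h2.fderiv
  rw [h3]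
  simp

theorem qd_reflect {ψ : EuclideanSpace ℝ (Fin d) → ℝ} (hψ : ContDiff ℝ (⊤ : ℕ∞) ψ)
    (x y v : EuclideanSpace ℝ (Fin d)) :
    qd (fun y => ψ (x - y)) v y = qd ψ v (x - y) := by
  rw [qd]
  simp_rw [fderiv_reflect hψ]
  rw [fderiv_fun_neg]
  simp only [neg_apply]
  rw [fderiv_reflect (dirder_contDiff hψ v), neg_neg, qd]

theorem dd_eq {g : EuclideanSpace ℝ (Fin d) → ℝ} (hg : ContDiff ℝ (⊤ : ℕ∞) g)
    (x v w : EuclideanSpace ℝ (Fin d)) :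
    fderiv ℝ (fun w => fderiv ℝ g w v) x w = fderiv ℝ (fderiv ℝ g) x w v := by
  have h : ContDiff ℝ (⊤ : ℕ∞) (fderiv ℝ g) := hg.fderiv_right (by simp)
  have h2 : DifferentiableAt ℝ (fderiv ℝ g) x := (h.differentiable (by simp)).differentiableAt
  rw [fderiv_clm_apply h2 (by fun_prop)]
  simp

theorem qd_expand {g : EuclideanSpace ℝ (Fin d) → ℝ} (hg : ContDiff ℝ (⊤ : ℕ∞) g)
    (x v : EuclideanSpace ℝ (Fin d)) :
    qd g v x = ∑ i, ∑ j, v i * v j * D2 g i j x := by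
  have hv : v = ∑ i, v i • EuclideanSpace.single i (1:ℝ) := by
    ext k
    simp [Finset.sum_apply, Pi.single_apply]
  simp_rw [qd, D2, dd_eq hg]
  conv_lhs => rw [hv]
  simp only [map_sum, map_smul, sum_apply, smul_apply,
    smul_eq_mul, Finset.mul_sum]
  rw [Finset.sum_comm]
  refine Finset.sum_congr rfl fun i _ => Finset.sum_congr rfl fun j _ => ?_
  ring

theorem sum_qd {g : EuclideanSpace ℝ (Fin d) → ℝ} (hg : ContDiff ℝ (⊤ : ℕ∞) g)
    (B : Matrix (Fin d) (Fin d) ℝ) (x : EuclideanSpace ℝ (Fin d)) :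
    ∑ k, qd g (bvec B k) x = ∑ i, ∑ j, (B.transpose * B) i j * D2 g i j x := by
  simp_rw [qd_expand hg]
  rw [Finset.sum_comm]
  refine Finset.sum_congr rfl fun i _ => ?_
  rw [Finset.sum_comm]
  refine Finset.sum_congr rfl fun j _ => ?_
  rw [Matrix.mul_apply, Finset.sum_mul]
  refine Finset.sum_congr rfl fun k _ => ?_
  simp [bvec]

section
open scoped MatrixOrder
theorem psd_factor (a : Matrix (Fin d) (Fin d) ℝ) (ha : a.PosSemidef) :
    ∃ B : Matrix (Fin d) (Fin d) ℝ, a = B.transpose * B := by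
  obtain ⟨B, h⟩ := CStarAlgebra.nonneg_iff_eq_star_mul_self.mp ha.nonneg
  refine ⟨B, ?_⟩
  rw [h, Matrix.star_eq_conjTranspose, Matrix.conjTranspose_eq_transpose_of_trivial]
end

theorem det_rpow (hd : 1 ≤ d) (B : Matrix (Fin d) (Fin d) ℝ) :
    (B.transpose * B).det ^ ((d:ℝ)⁻¹) = |B.det| ^ (2 / d : ℝ) := by
  rw [Matrix.det_mul, Matrix.det_transpose, ← abs_mul_abs_self, ← sq, ← Real.rpow_natCast,
    ← Real.rpow_mul (abs_nonneg _)]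
  norm_num [div_eq_mul_inv]

theorem psd_of_pd (hd : 1 ≤ d) {N c : ℝ} {h : Fin d → Fin d → ℝ}
    (H : ∀ a : Matrix (Fin d) (Fin d) ℝ, a.PosDef →
      c * a.det ^ ((d:ℝ)⁻¹) * N ≤ ∑ i, ∑ j, a i j * h i j)
    (a : Matrix (Fin d) (Fin d) ℝ) (ha : a.PosSemidef) :
    c * a.det ^ ((d:ℝ)⁻¹) * N ≤ ∑ i, ∑ j, a i j * h i j := by
  set A : ℝ → Matrix (Fin d) (Fin d) ℝ := fun η => a + η • 1 with hA
  have hAc : Continuous A := by fun_prop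
  have hA0 : A 0 = a := by simp [hA]
  have h1 : Continuous fun η => c * (A η).det ^ ((d:ℝ)⁻¹) * N := by
    have : Continuous fun η => (A η).det := hAc.matrix_det
    have h2 := this.rpow_const (p := (d:ℝ)⁻¹) fun η => Or.inr (by positivity)
    fun_prop
  have h2 : Continuous fun η => ∑ i, ∑ j, A η i j * h i j := by
    have : ∀ i j, Continuous fun η => A η i j := fun i j => hAc.matrix_elem i j
    fun_prop
  have t1 : Tendsto _ (𝓝[>] (0:ℝ)) _ := (h1.tendsto 0).mono_left nhdsWithin_le_nhds
  have t2 : Tendsto _ (𝓝[>] (0:ℝ)) _ := (h2.tendsto 0).mono_left nhdsWithin_le_nhds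
  rw [hA0] at t1 t2
  refine le_of_tendsto_of_tendsto t1 t2 ?_
  filter_upwards [self_mem_nhdsWithin] with η hη
  refine H _ ?_
  exact (Matrix.PosDef.one.smul hη).posSemidef_add ha

theorem mollify_eq (ζ : EuclideanSpace ℝ (Fin d) → ℝ) (ε : ℝ)
    (u : EuclideanSpace ℝ (Fin d) → ℝ) :
    mollify ζ ε u = fun x => ∫ y, u y * ((ε ^ d)⁻¹ * ζ (ε⁻¹ • (x - y))) := by
  funext x
  rw [mollify, ← integral_sub_left_eq_self (fun y => u (x - y) * ((ε ^ d)⁻¹ * ζ (ε⁻¹ • y))) volume x]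
  simp

theorem mollify_sub_const {ζ : EuclideanSpace ℝ (Fin d) → ℝ} (hζ : Continuous ζ)
    (hζc : HasCompactSupport ζ) {ε : ℝ} (hε : 0 < ε)
    {u : EuclideanSpace ℝ (Fin d) → ℝ} (hu : Continuous u) (c : ℝ) :
    mollify ζ ε (fun y => u y - c) = fun x => mollify ζ ε u x -
      ∫ y, c * ((ε ^ d)⁻¹ * ζ (ε⁻¹ • y)) := by
  funext x
  have hcs : HasCompactSupport fun y => ζ (ε⁻¹ • y) := hζc.comp_smul (inv_ne_zero hε.ne')
  have h1 : ∀ v : EuclideanSpace ℝ (Fin d) → ℝ, Continuous v →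
      Integrable fun y => v y * ((ε ^ d)⁻¹ * ζ (ε⁻¹ • y)) := fun v hv =>
    Continuous.integrable_of_hasCompactSupport (by fun_prop) (hcs.mul_left.mul_left)
  rw [mollify, mollify, ← integral_sub (h1 (fun y => u (x - y)) (by fun_prop)) (h1 (fun _ => c) (by fun_prop))]
  congr 1; funext y; ring

theorem D2_sub_const (g : EuclideanSpace ℝ (Fin d) → ℝ) (c : ℝ) (i j : Fin d)
    (x : EuclideanSpace ℝ (Fin d)) : D2 (fun x => g x - c) i j x = D2 g i j x := by
  simp_rw [D2, fderiv_sub_const]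

end final

/-- Theorem 2.3 of the paper: for `θ ∈ {0,1}` and `f ≥ 0` vanishing outside `B₂` with
`∫_{B₂} f^d < ∞` there is a nonpositive convex function `z` on `B₄` with
`|z| ≤ 8 Φ_θ(∫_{B₂} f^d)` and, for every mollifier `ζ`, every `ε ∈ (0,2)` and every
nonnegative symmetric matrix `a`,
`aⁱʲ D_{ij} z⁽ᵉ⁾ ≥ d (det a)^{1/d} (f (1 + θ |∇z|))⁽ᵉ⁾` on `B₂`. -/
theorem aleksandrov_mollified (d : ℕ) (hd : 1 ≤ d) (θ : ℝ) (hθ : θ = 0 ∨ θ = 1)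
    (Φ : ℝ → ℝ)
    (hΦ : ∀ ρ : ℝ, 0 ≤ ρ →
      Φ (∫ p in closedBall (0 : EuclideanSpace ℝ (Fin d)) ρ,
          (1 + θ * ‖p‖) ^ (-(d : ℝ))) = ρ)
    (f : EuclideanSpace ℝ (Fin d) → ℝ) (hf_meas : Measurable f) (hf0 : ∀ x, 0 ≤ f x)
    (hf_supp : ∀ x ∉ ball (0 : EuclideanSpace ℝ (Fin d)) 2, f x = 0)
    (hf_int : IntegrableOn (fun x => f x ^ d) (ball (0 : EuclideanSpace ℝ (Fin d)) 2)) :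
    ∃ z : EuclideanSpace ℝ (Fin d) → ℝ,
      ConvexOn ℝ (ball (0 : EuclideanSpace ℝ (Fin d)) 4) z ∧
      (∀ x ∈ ball (0 : EuclideanSpace ℝ (Fin d)) 4, z x ≤ 0) ∧
      (∀ x ∈ ball (0 : EuclideanSpace ℝ (Fin d)) 4,
        |z x| ≤ 8 * Φ (∫ y in ball (0 : EuclideanSpace ℝ (Fin d)) 2, f y ^ d)) ∧
      (∀ ζ : EuclideanSpace ℝ (Fin d) → ℝ, ContDiff ℝ (⊤ : ℕ∞) ζ → (∀ y, 0 ≤ ζ y) →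
        tsupport ζ ⊆ ball (0 : EuclideanSpace ℝ (Fin d)) 1 → (∫ y, ζ y) = 1 →
        ∀ ε ∈ Set.Ioo (0 : ℝ) 2, ∀ a : Matrix (Fin d) (Fin d) ℝ, a.PosSemidef →
        ∀ x ∈ ball (0 : EuclideanSpace ℝ (Fin d)) 2,
          (d : ℝ) * a.det ^ ((d : ℝ)⁻¹) *
              mollify ζ ε (fun y => f y * (1 + θ * ‖fderiv ℝ z y‖)) x ≤
            ∑ i, ∑ j, a i j * D2 (mollify ζ ε z) i j x) := by
  classical
  have hθ0 : 0 ≤ θ := by rcases hθ with h | h <;> simp [h]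
  have hθ1 : θ ≤ 1 := by rcases hθ with h | h <;> simp [h]
  obtain ⟨hfi, hfd, hfin, hmr, hμ⟩ := f_facts hd hf_meas hf0 hf_supp hf_int
  set M := ∫ y in ball (0 : EuclideanSpace ℝ (Fin d)) 2, f y ^ d with hM
  have hM0 : 0 ≤ M := integral_nonneg fun y => pow_nonneg (hf0 y) d
  obtain ⟨ρ, hρ, hρM⟩ := exists_rho (d := d) hd hθ0 hθ1 hM0
  have hΦM : Φ M = ρ := by rw [← hρM]; exact hΦ ρ hρ
  rw [hΦM]
  rcases hM0.eq_or_lt with hz | hMpos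
  · have hf_ae : ∀ᵐ y, f y = 0 := by
      have h1 : (fun y => f y ^ d) =ᵐ[volume.restrict (ball 0 2)] 0 :=
        (setIntegral_eq_zero_iff_of_nonneg_ae (ae_of_all _ fun y => pow_nonneg (hf0 y) d)
          hf_int).1 hz.symm
      have h2 := (ae_restrict_iff' measurableSet_ball).1 h1
      filter_upwards [h2] with y hy
      by_cases hyb : y ∈ ball (0 : EuclideanSpace ℝ (Fin d)) 2
      · exact pow_eq_zero_iff (by omega) |>.1 (hy hyb)
      · exact hf_supp y hyb
    refine ⟨fun _ => 0, convexOn_const _ (convex_ball _ _), by simp, ?_, ?_⟩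
    · intro x _
      simp only [abs_zero]; positivity
    · intro ζ _ _ _ _ ε _ a _ x _
      have e1 : mollify ζ ε (fun y => f y * (1 + θ * ‖fderiv ℝ
          (fun _ : EuclideanSpace ℝ (Fin d) => (0:ℝ)) y‖)) x = 0 := by
        rw [mollify_eq]
        refine integral_eq_zero_of_ae ?_
        filter_upwards [hf_ae] with y hy
        simp [hy]
      have e2 : mollify ζ ε (fun _ => 0) = fun _ => 0 := by
        funext x; simp [mollify]
      rw [e1, e2]
      simp [D2]
  have hρpos : 0 < ρ := by
    rcases hρ.eq_or_lt with h | h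
    · exfalso
      have : Nonempty (Fin d) := ⟨⟨0, by omega⟩⟩
      rw [← h] at hρM
      simp at hρM
      linarith
    · exact h
  have := gam_finite (d := d) hθ0 ρ
  have := hfin
  have hm : (gam (d := d) ρ θ).real Set.univ = (muf f).real Set.univ := by
    rw [gam_real hθ0, hmr, hρM]
  have hγ := gam_ae (d := d) θ ρ
  obtain ⟨w0, h0, h00⟩ := exists_isMinJ (T := id) hρ hγ measurable_id
    (hμ.mono fun x hx => by simpa using hx.trans (by norm_num)) hm
  set Z := cj (closedBall 0 ρ) w0 with hZe
  have hKc := isCompact_closedBall (0 : EuclideanSpace ℝ (Fin d)) ρ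
  have hKn : (closedBall (0 : EuclideanSpace ℝ (Fin d)) ρ).Nonempty := ⟨0, by simp [hρ]⟩
  have hw0c := h0.1.continuous
  have hZL : LipschitzWith ⟨ρ, hρ⟩ Z := cj_lipschitz hKc hKn hw0c fun p hp =>
    mem_closedBall_zero_iff.1 hp
  have hZc := hZL.continuous
  have hZconv : ConvexOn ℝ Set.univ Z := cj_convex hKc hKn hw0c
  have hbd : ∀ x ∈ ball (0 : EuclideanSpace ℝ (Fin d)) 4, |Z x - Z 0| ≤ 4 * ρ := by
    intro x hx
    have h1 := hZL.dist_le_mul x 0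
    rw [Real.dist_eq] at h1
    refine h1.trans ?_
    have h2 : dist x 0 ≤ 4 := (mem_ball.1 hx).le
    have : ρ * dist x 0 ≤ ρ * 4 := by gcongr
    calc _ ≤ ρ * 4 := this
      _ = _ := by ring
  refine ⟨fun x => Z x - (Z 0 + 4 * ρ), ?_, ?_, ?_, ?_⟩
  · have h := (hZconv.subset (Set.subset_univ _) (convex_ball 0 4)).add_const (-(Z 0 + 4 * ρ))
    simpa [sub_eq_add_neg, Pi.add_def] using h
  · intro x hx
    have := abs_le.1 (hbd x hx)
    linarith [this.2]
  · intro x hx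
    have := abs_le.1 (hbd x hx)
    rw [abs_le]
    constructor <;> linarith [this.1, this.2]
  intro ζ hζ hζ0 hζs _ ε hε a ha x _
  have hε0 : 0 < ε := hε.1
  have hζc : HasCompactSupport ζ := (isCompact_closedBall (0 : EuclideanSpace ℝ (Fin d)) 1).of_isClosed_subset
    (isClosed_tsupport _) (hζs.trans ball_subset_closedBall)
  set ψ : EuclideanSpace ℝ (Fin d) → ℝ := fun y => (ε ^ d)⁻¹ * ζ (ε⁻¹ • y) with hψe
  have hψ : ContDiff ℝ (⊤ : ℕ∞) ψ :=
    contDiff_const.mul (hζ.comp (contDiff_const_smul _))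
  have hψc : HasCompactSupport ψ := by
    have : HasCompactSupport fun y => ζ (ε⁻¹ • y) := hζc.comp_smul (inv_ne_zero hε0.ne')
    exact this.mul_left
  have hψ0 : ∀ y, 0 ≤ ψ y := fun y => mul_nonneg (by positivity) (hζ0 _)
  rw [mollify_sub_const hζ.continuous hζc hε0 hZc]
  simp_rw [D2_sub_const, fderiv_sub_const]
  rw [mollify_eq ζ ε Z, mollify_eq ζ ε (fun y => f y * (1 + θ * ‖fderiv ℝ Z y‖))]
  refine psd_of_pd hd (fun a ha => ?_) a ha
  obtain ⟨B, hB⟩ := psd_factor a ha.posSemidef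
  have hdet : B.det ≠ 0 := by
    intro h
    have := ha.det_pos
    rw [hB, Matrix.det_mul, h, mul_zero] at this
    exact lt_irrefl _ this
  have hG : ContDiff ℝ (⊤ : ℕ∞) fun x => ∫ y, Z y * ψ (x - y) := cv_smooth hZc hψ hψc
  have key := sum_qd hG B x
  rw [← hB] at key
  change _ ≤ ∑ i, ∑ j, a i j * D2 (fun x => ∫ y, Z y * ψ (x - y)) i j x
  rw [← key]
  simp_rw [cv_qd hZc hψ hψc]
  have hφ : ContDiff ℝ (⊤ : ℕ∞) fun y => ψ (x - y) := hψ.comp (contDiff_const.sub contDiff_id)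
  have hφc : HasCompactSupport fun y => ψ (x - y) :=
    hψc.comp_homeomorph (Homeomorph.subLeft x)
  have hint : ∀ k ∈ Finset.univ, Integrable fun y => Z y * qd ψ (bvec B k) (x - y) := by
    intro k _
    have c1 : Continuous fun y => qd ψ (bvec B k) (x - y) :=
      (qd_continuous hψ _).comp (by fun_prop)
    have c2 : HasCompactSupport fun y => qd ψ (bvec B k) (x - y) :=
      (qd_hcs hψc _).comp_homeomorph (Homeomorph.subLeft x)
    exact (hZc.mul c1).integrable_of_hasCompactSupport c2.mul_left
  rw [← integral_finsetSum _ hint]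
  have hfin2 := limit_ineq (M := ∫ y, Z y * ∑ k, qd (fun y => ψ (x - y)) (bvec B k) y)
    (c := d * |B.det| ^ (2 / d : ℝ)) hd hρ hθ0 hfi hZL hφ.continuous hφc fun s hs =>
    limit_s hd hρ hθ0 hγ (gam_pos hθ0 hρpos) hm hf0 hfi hfd hμ h0 h00 hZe B hdet hs
      (ndir_measurable Z) (ndir_norm Z) hφ hφc fun y => hψ0 _
  simp_rw [qd_reflect hψ, Finset.mul_sum] at hfin2
  rw [hB, det_rpow hd]
  refine le_trans (le_of_eq ?_) hfin2
  congr 2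
  funext y
  ring
end
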